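/- arXiv:1205.3841 — 9 statements merged into one kernel-verified Lean document; each statement's English description precedes it below -/
import Mathlib

section
/- Suppose all entries of the i-th row of A are nonnegative: a_{il} ≥ 0 for all l. Then for every x ∈ S^{m-1} with x_i > 0 one has lim_{k→∞} ∑_{l=1}^m a_{il} (V^k x)_l = 0. -/
/-- The Volterra quadratic stochastic operator associated with
a skew-symmetric matrix `A`. -/
noncomputable def volterraOp {m : ℕ} (A : Matrix (Fin m) (Fin m) ℝ)
    (x : Fin m → ℝ) : Fin m → ℝ :=
  fun k => x k * (1 + ∑ i, A k i * x i)

/-- The quadratic form of a skew-symmetric matrix vanishes. -/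
theorem sum_mul_sum_eq_zero_of_skew {m : ℕ} {A : Matrix (Fin m) (Fin m) ℝ}
    (hskew : ∀ i j, A j i = -A i j) (x : Fin m → ℝ) :
    ∑ k, x k * ∑ i, A k i * x i = 0 := by
  have h : ∑ k, x k * ∑ i, A k i * x i = -∑ k, x k * ∑ i, A k i * x i := by
    simp only [Finset.mul_sum]
    conv_lhs => rw [Finset.sum_comm]
    simp only [← Finset.sum_neg_distrib]
    refine Finset.sum_congr rfl fun k _ => Finset.sum_congr rfl fun i _ => ?_
    rw [hskew k i]
    ring
  linarith

/-- A Volterra operator maps the standard simplex into itself. -/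
theorem volterraOp_mapsTo_stdSimplex {m : ℕ} {A : Matrix (Fin m) (Fin m) ℝ}
    (hskew : ∀ i j, A j i = -A i j) (hbd : ∀ i j, |A i j| ≤ 1) :
    Set.MapsTo (volterraOp A) (stdSimplex ℝ (Fin m)) (stdSimplex ℝ (Fin m)) := by
  rintro x ⟨hx, hsum⟩
  refine ⟨fun k => mul_nonneg (hx k) ?_, ?_⟩
  · have h : ∑ i, -x i ≤ ∑ i, A k i * x i :=
      Finset.sum_le_sum fun i _ => by nlinarith [(abs_le.1 (hbd k i)).1, hx i]
    rw [Finset.sum_neg_distrib, hsum] at h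
    linarith
  · simp only [volterraOp, mul_add, mul_one, Finset.sum_add_distrib,
      sum_mul_sum_eq_zero_of_skew hskew, hsum, add_zero]

/-- If all entries of the `i`-th row of `A` are nonnegative, then for
every simplex point `x` with `x_i > 0` one has `∑_l a_{il} (V^k x)_l → 0`. -/
theorem stmt_3 {m : ℕ} (A : Matrix (Fin m) (Fin m) ℝ)
    (hskew : ∀ i j, A j i = -A i j) (hbd : ∀ i j, |A i j| ≤ 1)
    (i : Fin m) (hrow : ∀ l, 0 ≤ A i l)
    (x : Fin m → ℝ) (hx : ∀ j, 0 ≤ x j) (hxsum : ∑ j, x j = 1)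
    (hxi : 0 < x i) :
    Filter.Tendsto (fun k : ℕ => ∑ l, A i l * (volterraOp A)^[k] x l)
      Filter.atTop (nhds 0) := by
  have hmem (k : ℕ) : (volterraOp A)^[k] x ∈ stdSimplex ℝ (Fin m) :=
    (volterraOp_mapsTo_stdSimplex hskew hbd).iterate k ⟨hx, hxsum⟩
  set u : ℕ → ℝ := fun k => (volterraOp A)^[k] x i with hu
  have hstep (k : ℕ) : u (k + 1) = u k * (1 + ∑ l, A i l * (volterraOp A)^[k] x l) := by
    simp only [hu, Function.iterate_succ_apply', volterraOp]
  have hmono : Monotone u := monotone_nat_of_le_succ fun k => by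
    rw [hstep]
    refine le_mul_of_one_le_right ((hmem k).1 i) (le_add_of_nonneg_right ?_)
    exact Finset.sum_nonneg fun l _ => mul_nonneg (hrow l) ((hmem k).1 l)
  have hpos (k : ℕ) : 0 < u k := hxi.trans_le (hmono (Nat.zero_le k))
  have hbdd : BddAbove (Set.range u) := by
    refine ⟨1, ?_⟩
    rintro _ ⟨k, rfl⟩
    exact (hmem k).2 ▸ Finset.single_le_sum (fun j _ => (hmem k).1 j) (Finset.mem_univ i)
  have hlim := tendsto_atTop_ciSup hmono hbdd
  have hne : (⨆ k, u k) ≠ 0 := ((hpos 0).trans_le (le_ciSup hbdd 0)).ne'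
  have hratio := ((hlim.comp (Filter.tendsto_add_atTop_nat 1)).div hlim hne).sub_const 1
  rw [div_self hne, sub_self] at hratio
  refine hratio.congr fun k => ?_
  simp only [Pi.div_apply, Function.comp_apply]
  rw [hstep, mul_div_cancel_left₀ _ (hpos k).ne', add_sub_cancel_left]
end

section
/- Suppose a_{il} > 0 for every l ≠ i. Then for every x ∈ S^{m-1} with x_i > 0 the trajectory converges to the i-th vertex: V^k x → e_i as k → ∞, where e_i is the i-th standard basis vector of ℝ^m. -/
open Filter Topology

lemma sum_sum_mul_eq_zero_of_skew {ι : Type*} [Fintype ι] {A : Matrix ι ι ℝ}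
    (hskew : ∀ i j, A j i = -A i j) (x : ι → ℝ) :
    ∑ k, x k * ∑ l, A k l * x l = 0 := by
  have h : ∑ k, x k * ∑ l, A k l * x l = -∑ k, x k * ∑ l, A k l * x l := by
    simp only [Finset.mul_sum]
    conv_lhs => rw [Finset.sum_comm]
    simp only [← Finset.sum_neg_distrib]
    refine Finset.sum_congr rfl fun k _ => Finset.sum_congr rfl fun l _ => ?_
    rw [hskew k l]
    ring
  linarith

/-- The Volterra operator of a skew-symmetric matrix with entries in `[-1, 1]` preserves
the standard simplex. -/
lemma volterraOp_mem_stdSimplex {m : ℕ} {A : Matrix (Fin m) (Fin m) ℝ}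
    (hskew : ∀ i j, A j i = -A i j) (hbd : ∀ i j, |A i j| ≤ 1)
    {x : Fin m → ℝ} (hx : x ∈ stdSimplex ℝ (Fin m)) :
    volterraOp A x ∈ stdSimplex ℝ (Fin m) := by
  refine ⟨fun k => mul_nonneg (hx.1 k) ?_, ?_⟩
  · have h : ∑ l, -x l ≤ ∑ l, A k l * x l := Finset.sum_le_sum fun l _ => by
      nlinarith [hx.1 l, (abs_le.mp (hbd k l)).1]
    rw [Finset.sum_neg_distrib, hx.2] at h
    linarith
  · simp only [volterraOp, mul_add, mul_one, Finset.sum_add_distrib,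
      sum_sum_mul_eq_zero_of_skew hskew, hx.2, add_zero]

/-- If the `i`-th row of `A` is nonnegative, one step of the Volterra operator raises the
`i`-th coordinate by at least the contribution of any single other coordinate. -/
lemma add_mul_le_volterraOp {m : ℕ} {A : Matrix (Fin m) (Fin m) ℝ} {i : Fin m}
    (hrow : ∀ l, 0 ≤ A i l) {x : Fin m → ℝ} (hx : ∀ j, 0 ≤ x j) (l : Fin m) :
    x i + x i * (A i l * x l) ≤ volterraOp A x i := by
  have h : A i l * x l ≤ ∑ j, A i j * x j :=
    Finset.single_le_sum (f := fun j => A i j * x j)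
      (fun j _ => mul_nonneg (hrow j) (hx j)) (Finset.mem_univ l)
  have := mul_le_mul_of_nonneg_left h (hx i)
  simp only [volterraOp]
  linarith

/-- A sequence in the standard simplex all of whose coordinates other than the `i`-th tend to
zero converges to the `i`-th vertex. -/
lemma tendsto_single_of_mem_stdSimplex {ι α : Type*} [Fintype ι] [DecidableEq ι] {f : Filter α}
    {u : α → ι → ℝ} (hu : ∀ a, u a ∈ stdSimplex ℝ ι) {i : ι}
    (h : ∀ l, l ≠ i → Tendsto (fun a => u a l) f (𝓝 0)) :
    Tendsto u f (𝓝 (Pi.single i 1)) := by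
  refine tendsto_pi_nhds.mpr fun l => ?_
  by_cases hl : l = i
  · subst hl
    have hs : Tendsto (fun a => 1 - ∑ j ∈ Finset.univ.erase l, u a j) f (𝓝 (1 - 0)) := by
      refine tendsto_const_nhds.sub ?_
      simpa using tendsto_finsetSum (Finset.univ.erase l)
        fun j hj => h j (Finset.ne_of_mem_erase hj)
    rw [Pi.single_eq_same]
    convert hs using 2 with a
    · rw [← (hu a).2, ← Finset.add_sum_erase _ _ (Finset.mem_univ l)]
      ring
    · simp
  · rw [Pi.single_eq_of_ne hl]
    exact h l hl

/-- If `a_{il} > 0` for all `l ≠ i`, then every simplex point with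
`x_i > 0` has trajectory converging to the `i`-th vertex. -/
theorem stmt_4 {m : ℕ} (A : Matrix (Fin m) (Fin m) ℝ)
    (hskew : ∀ i j, A j i = -A i j) (hbd : ∀ i j, |A i j| ≤ 1)
    (i : Fin m) (hrow : ∀ l, l ≠ i → 0 < A i l)
    (x : Fin m → ℝ) (hx : ∀ j, 0 ≤ x j) (hxsum : ∑ j, x j = 1)
    (hxi : 0 < x i) :
    Filter.Tendsto (fun k : ℕ => (volterraOp A)^[k] x)
      Filter.atTop (nhds (Pi.single i 1)) := by
  have hrow' : ∀ l, 0 ≤ A i l := fun l => by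
    by_cases hl : l = i
    · subst hl
      linarith [hskew l l]
    · exact (hrow l hl).le
  set u : ℕ → Fin m → ℝ := fun k => (volterraOp A)^[k] x
  have hsucc : ∀ k, u (k + 1) = volterraOp A (u k) :=
    fun k => Function.iterate_succ_apply' _ _ _
  have hmem : ∀ k, u k ∈ stdSimplex ℝ (Fin m) := fun k => by
    induction k with
    | zero => exact ⟨hx, hxsum⟩
    | succ k ih => exact hsucc k ▸ volterraOp_mem_stdSimplex hskew hbd ih
  have hstep : ∀ k l, u k i + u k i * (A i l * u k l) ≤ u (k + 1) i := fun k l =>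
    hsucc k ▸ add_mul_le_volterraOp hrow' (hmem k).1 l
  have hmono : Monotone fun k => u k i := monotone_nat_of_le_succ fun k => by
    have := mul_nonneg ((hmem k).1 i) (mul_nonneg (hrow' i) ((hmem k).1 i))
    linarith [hstep k i]
  have hlim := tendsto_atTop_ciSup hmono
    ⟨1, by rintro _ ⟨k, rfl⟩; exact ((mem_Icc_of_mem_stdSimplex (hmem k)) i).2⟩
  have hdiff : Tendsto (fun k => u (k + 1) i - u k i) atTop (𝓝 0) := by
    simpa using (hlim.comp (tendsto_add_atTop_nat 1)).sub hlim
  refine tendsto_single_of_mem_stdSimplex hmem fun l hl => ?_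
  have hc : 0 < x i * A i l := mul_pos hxi (hrow l hl)
  refine squeeze_zero (fun k => (hmem k).1 l) (fun k => ?_)
    (by simpa using hdiff.div_const (x i * A i l))
  rw [le_div_iff₀ hc]
  have h0 : x i ≤ u k i := hmono (Nat.zero_le k)
  have := mul_le_mul_of_nonneg_right h0 (mul_nonneg (hrow' l) ((hmem k).1 l))
  linarith [hstep k l]
end

section
/- The operator V has no fixed point x ∈ S³ whose support consists of exactly two indices (i.e. no fixed points in the relative interiors of the edges of S³), no fixed point x with x₁, x₂, x₃ > 0 and x₄ = 0, and no fixed point x with x₂, x₃, x₄ > 0 and x₁ = 0. -/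
/-- The three-dimensional simplex `S³ ⊆ ℝ⁴`. -/
def simplex3 : Set (Fin 4 → ℝ) := {x | (∀ i, 0 ≤ x i) ∧ ∑ i, x i = 1}

/-- The Volterra operator `(Vx)_k = x_k (1 + (Ax)_k)` associated with the canonical
third-class skew-symmetric matrix with rows `(0, a12, a13, -a14)`, `(-a12, 0, a23, a24)`,
`(-a13, -a23, 0, a34)`, `(a14, -a24, -a34, 0)`. -/
noncomputable def volterra3 (a12 a13 a14 a23 a24 a34 : ℝ)
    (x : Fin 4 → ℝ) : Fin 4 → ℝ :=
  ![x 0 * (1 + (a12 * x 1 + a13 * x 2 + -a14 * x 3)),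
    x 1 * (1 + (-a12 * x 0 + a23 * x 2 + a24 * x 3)),
    x 2 * (1 + (-a13 * x 0 + -a23 * x 1 + a34 * x 3)),
    x 3 * (1 + (a14 * x 0 + -a24 * x 1 + -a34 * x 2))]

/-- A fixed point of the Volterra operator annihilates each product `x_k (Ax)_k`. -/
theorem mul_eq_zero_of_volterra3_eq_self {a12 a13 a14 a23 a24 a34 : ℝ} {x : Fin 4 → ℝ}
    (h : volterra3 a12 a13 a14 a23 a24 a34 x = x) :
    x 0 * (a12 * x 1 + a13 * x 2 - a14 * x 3) = 0 ∧
    x 1 * (-a12 * x 0 + a23 * x 2 + a24 * x 3) = 0 ∧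
    x 2 * (-a13 * x 0 - a23 * x 1 + a34 * x 3) = 0 ∧
    x 3 * (a14 * x 0 - a24 * x 1 - a34 * x 2) = 0 := by
  have h0 := congrFun h 0
  have h1 := congrFun h 1
  have h2 := congrFun h 2
  have h3 := congrFun h 3
  simp only [volterra3, Matrix.cons_val] at h0 h1 h2 h3
  refine ⟨?_, ?_, ?_, ?_⟩ <;> linarith

/-- `V` has no fixed point supported on exactly two indices, none with
`x₁,x₂,x₃ > 0, x₄ = 0`, and none with `x₂,x₃,x₄ > 0, x₁ = 0`. -/
theorem stmt_8 (a12 a13 a14 a23 a24 a34 : ℝ)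
    (h12 : a12 ∈ Set.Ioo (0 : ℝ) 1) (h13 : a13 ∈ Set.Ioo (0 : ℝ) 1)
    (h14 : a14 ∈ Set.Ioo (0 : ℝ) 1) (h23 : a23 ∈ Set.Ioo (0 : ℝ) 1)
    (h24 : a24 ∈ Set.Ioo (0 : ℝ) 1) (h34 : a34 ∈ Set.Ioo (0 : ℝ) 1) :
    (∀ x ∈ simplex3, volterra3 a12 a13 a14 a23 a24 a34 x = x →
      (Function.support x).ncard ≠ 2) ∧
    (∀ x ∈ simplex3, volterra3 a12 a13 a14 a23 a24 a34 x = x →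
      ¬(0 < x 0 ∧ 0 < x 1 ∧ 0 < x 2 ∧ x 3 = 0)) ∧
    (∀ x ∈ simplex3, volterra3 a12 a13 a14 a23 a24 a34 x = x →
      ¬(0 < x 1 ∧ 0 < x 2 ∧ 0 < x 3 ∧ x 0 = 0)) := by
  obtain ⟨p12, -⟩ := h12
  obtain ⟨p13, -⟩ := h13
  obtain ⟨p14, -⟩ := h14
  obtain ⟨p23, -⟩ := h23
  obtain ⟨p24, -⟩ := h24
  obtain ⟨p34, -⟩ := h34
  refine ⟨fun x _ hx hcard => ?_, fun x _ hx ⟨h0, h1, h2, h3⟩ => ?_,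
    fun x _ hx ⟨h1, h2, h3, h0⟩ => ?_⟩
  · obtain ⟨e0, e1, e2, e3⟩ := mul_eq_zero_of_volterra3_eq_self hx
    obtain ⟨i, j, hij, hs⟩ := Set.ncard_eq_two.mp hcard
    have hsupp (k : Fin 4) : x k ≠ 0 ↔ k = i ∨ k = j := by
      simpa using Set.ext_iff.mp hs k
    have s0 := hsupp 0
    have s1 := hsupp 1
    have s2 := hsupp 2
    have s3 := hsupp 3
    clear hsupp hs hcard hx
    fin_cases i <;> fin_cases j <;>
      simp_all [p12.ne', p13.ne', p14.ne', p23.ne', p24.ne', p34.ne']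
  · obtain ⟨e0, -, -, -⟩ := mul_eq_zero_of_volterra3_eq_self hx
    have : 0 < x 0 * (a12 * x 1 + a13 * x 2) := by positivity
    rw [h3] at e0
    linarith
  · obtain ⟨-, e1, -, -⟩ := mul_eq_zero_of_volterra3_eq_self hx
    have : 0 < x 1 * (a23 * x 2 + a24 * x 3) := by positivity
    rw [h0] at e1
    linarith
end

section
/- The point p = (a₃₄, 0, a₁₄, a₁₃)/(a₃₄ + a₁₄ + a₁₃) is the unique fixed point of V in S³ with x₁, x₃, x₄ > 0 and x₂ = 0, and the point q = (a₂₄, a₁₄, 0, a₁₂)/(a₂₄ + a₁₄ + a₁₂) is the unique fixed point of V in S³ with x₁, x₂, x₄ > 0 and x₃ = 0. -/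
/-- A positive number fixed by multiplication with `1 + t` forces `t = 0`. -/
lemma eq_zero_of_mul_one_add_eq_self {a t : ℝ} (ha : 0 < a) (h : a * (1 + t) = a) : t = 0 := by
  have h' : a * t = 0 := by linear_combination h
  exact (mul_eq_zero.mp h').resolve_left ha.ne'

/-- `p = (a₃₄,0,a₁₄,a₁₃)/(a₃₄+a₁₄+a₁₃)` is the unique fixed point of `V`
in the (relative interior of the) face `x₂ = 0`, and
`q = (a₂₄,a₁₄,0,a₁₂)/(a₂₄+a₁₄+a₁₂)` the unique one in the face `x₃ = 0`. -/
theorem stmt_9 (a12 a13 a14 a23 a24 a34 : ℝ)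
    (h12 : a12 ∈ Set.Ioo (0 : ℝ) 1) (h13 : a13 ∈ Set.Ioo (0 : ℝ) 1)
    (h14 : a14 ∈ Set.Ioo (0 : ℝ) 1) (h23 : a23 ∈ Set.Ioo (0 : ℝ) 1)
    (h24 : a24 ∈ Set.Ioo (0 : ℝ) 1) (h34 : a34 ∈ Set.Ioo (0 : ℝ) 1)
    (p q : Fin 4 → ℝ)
    (hp : p = fun i => ![a34, 0, a14, a13] i / (a34 + a14 + a13))
    (hq : q = fun i => ![a24, a14, 0, a12] i / (a24 + a14 + a12)) :
    (p ∈ simplex3 ∧ volterra3 a12 a13 a14 a23 a24 a34 p = p ∧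
      0 < p 0 ∧ p 1 = 0 ∧ 0 < p 2 ∧ 0 < p 3 ∧
      (∀ x ∈ simplex3, volterra3 a12 a13 a14 a23 a24 a34 x = x →
        0 < x 0 → x 1 = 0 → 0 < x 2 → 0 < x 3 → x = p)) ∧
    (q ∈ simplex3 ∧ volterra3 a12 a13 a14 a23 a24 a34 q = q ∧
      0 < q 0 ∧ 0 < q 1 ∧ q 2 = 0 ∧ 0 < q 3 ∧
      (∀ x ∈ simplex3, volterra3 a12 a13 a14 a23 a24 a34 x = x →
        0 < x 0 → 0 < x 1 → x 2 = 0 → 0 < x 3 → x = q)) := by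
  obtain ⟨h12, -⟩ := h12
  obtain ⟨h13, -⟩ := h13
  obtain ⟨h14, -⟩ := h14
  obtain ⟨h24, -⟩ := h24
  obtain ⟨h34, -⟩ := h34
  subst hp hq
  constructor
  · have hs : 0 < a34 + a14 + a13 := by positivity
    refine ⟨⟨?_, ?_⟩, ?_, ?_, ?_, ?_, ?_, ?_⟩
    · intro i
      fin_cases i <;> simp <;> positivity
    · simp [Fin.sum_univ_four]
      field_simp
    · ext i
      fin_cases i <;> simp [volterra3] <;> field_simp <;> ring
    iterate 4 simp <;> positivity
    · rintro x ⟨-, hsum⟩ hfix hx0 hx1 hx2 hx3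
      rw [Fin.sum_univ_four] at hsum
      have e0 := congrFun hfix 0
      have e2 := congrFun hfix 2
      have e3 := congrFun hfix 3
      simp only [volterra3, Matrix.cons_val] at e0 e2 e3
      replace e0 := eq_zero_of_mul_one_add_eq_self hx0 e0
      replace e2 := eq_zero_of_mul_one_add_eq_self hx2 e2
      replace e3 := eq_zero_of_mul_one_add_eq_self hx3 e3
      rw [hx1] at hsum e0 e2 e3
      ext i
      fin_cases i <;> simp [hx1] <;> rw [eq_div_iff hs.ne']
      · linear_combination a34 * hsum + e3 - e2
      · linear_combination a14 * hsum + e0 - e3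
      · linear_combination a13 * hsum + e2 - e0
  · have hs : 0 < a24 + a14 + a12 := by positivity
    refine ⟨⟨?_, ?_⟩, ?_, ?_, ?_, ?_, ?_, ?_⟩
    · intro i
      fin_cases i <;> simp <;> positivity
    · simp [Fin.sum_univ_four]
      field_simp
    · ext i
      fin_cases i <;> simp [volterra3] <;> field_simp <;> ring
    iterate 4 simp <;> positivity
    · rintro x ⟨-, hsum⟩ hfix hx0 hx1 hx2 hx3
      rw [Fin.sum_univ_four] at hsum
      have e0 := congrFun hfix 0
      have e1 := congrFun hfix 1
      have e3 := congrFun hfix 3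
      simp only [volterra3, Matrix.cons_val] at e0 e1 e3
      replace e0 := eq_zero_of_mul_one_add_eq_self hx0 e0
      replace e1 := eq_zero_of_mul_one_add_eq_self hx1 e1
      replace e3 := eq_zero_of_mul_one_add_eq_self hx3 e3
      rw [hx2] at hsum e0 e1 e3
      ext i
      fin_cases i <;> simp [hx2] <;> rw [eq_div_iff hs.ne']
      · linear_combination a24 * hsum + e3 - e1
      · linear_combination a14 * hsum + e0 - e3
      · linear_combination a12 * hsum + e1 - e0
end

section
/- Let p ∈ S^{m-1} be such that every coordinate of the vector Ap is nonnegative: (Ap)_i ≥ 0 for all i. Then the function F(x) = ∏_{i=1}^m x_i^{p_i} is a Lyapunov function for V, i.e. F(Vx) ≤ F(x) for every x ∈ S^{m-1}. -/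
/-- The growth factors of a Volterra operator are nonnegative on the simplex. -/
theorem volterra_factor_nonneg {m : ℕ} {A : Matrix (Fin m) (Fin m) ℝ}
    (hbd : ∀ i j, |A i j| ≤ 1) {x : Fin m → ℝ} (hx : ∀ i, 0 ≤ x i) (hxsum : ∑ i, x i = 1)
    (k : Fin m) : 0 ≤ 1 + ∑ i, A k i * x i := by
  rw [← hxsum, ← Finset.sum_add_distrib]
  refine Finset.sum_nonneg fun i _ => ?_
  nlinarith [(abs_le.mp (hbd k i)).1, hx i]

/-- For skew-symmetric `A`, the bilinear form `⟨p, A x⟩` equals `-⟨x, A p⟩`. -/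
theorem sum_mul_sum_eq_neg_of_skew {m : ℕ} {A : Matrix (Fin m) (Fin m) ℝ}
    (hskew : ∀ i j, A j i = -A i j) (p x : Fin m → ℝ) :
    ∑ k, p k * ∑ i, A k i * x i = -∑ i, x i * ∑ k, A i k * p k := by
  simp only [Finset.mul_sum, ← Finset.sum_neg_distrib]
  rw [Finset.sum_comm]
  refine Finset.sum_congr rfl fun i _ => Finset.sum_congr rfl fun k _ => ?_
  rw [hskew i k]
  ring

/-- If `p` is a simplex point with `(Ap)_i ≥ 0` for all `i`, then
`F(x) = ∏ x_i ^ p_i` (real powers) is a Lyapunov function: `F(Vx) ≤ F(x)` on the simplex. -/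
theorem stmt_10 {m : ℕ} (A : Matrix (Fin m) (Fin m) ℝ)
    (hskew : ∀ i j, A j i = -A i j) (hbd : ∀ i j, |A i j| ≤ 1)
    (p : Fin m → ℝ) (hp : ∀ i, 0 ≤ p i) (hpsum : ∑ i, p i = 1)
    (hAp : ∀ i, 0 ≤ ∑ j, A i j * p j)
    (x : Fin m → ℝ) (hx : ∀ i, 0 ≤ x i) (hxsum : ∑ i, x i = 1) :
    ∏ i, (volterraOp A x i) ^ (p i) ≤ ∏ i, (x i) ^ (p i) := by
  have hc := volterra_factor_nonneg hbd hx hxsum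
  have amgm : ∏ k, (1 + ∑ i, A k i * x i) ^ p k ≤ ∑ k, p k * (1 + ∑ i, A k i * x i) :=
    Real.geom_mean_le_arith_mean_weighted _ _ _ (fun i _ => hp i) hpsum fun i _ => hc i
  have mean_le : ∑ k, p k * (1 + ∑ i, A k i * x i) ≤ 1 := by
    simp only [mul_add, mul_one, Finset.sum_add_distrib, hpsum]
    rw [sum_mul_sum_eq_neg_of_skew hskew]
    have := Finset.sum_nonneg fun i (_ : i ∈ Finset.univ) => mul_nonneg (hx i) (hAp i)
    linarith
  calc ∏ i, (volterraOp A x i) ^ (p i)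
      = (∏ i, x i ^ p i) * ∏ k, (1 + ∑ i, A k i * x i) ^ p k := by
        rw [← Finset.prod_mul_distrib]
        exact Finset.prod_congr rfl fun i _ => Real.mul_rpow (hx i) (hc i)
    _ ≤ ∏ i, x i ^ p i :=
        mul_le_of_le_one_right (Finset.prod_nonneg fun i _ => Real.rpow_nonneg (hx i) _)
          (amgm.trans mean_le)
end

section
/- Assume I := −a₁₂a₃₄ + a₁₃a₂₄ + a₁₄a₂₃ ≥ 0. Then the function F(x) = x₁^{a₃₄} · x₃^{a₁₄} · x₄^{a₁₃} satisfies F(Vx) ≤ F(x) for every x ∈ S³; in particular n ↦ F(Vⁿx) is nonincreasing along every trajectory. -/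
/-- A linear form with coefficients at least `-1` is at least `-1` on the simplex. -/
theorem one_add_nonneg_of_mem_simplex3 {x : Fin 4 → ℝ} (hx : x ∈ simplex3) (c : Fin 4 → ℝ)
    (hc : ∀ i, -1 ≤ c i) : 0 ≤ 1 + ∑ i, c i * x i := by
  have h : ∑ i, -1 * x i ≤ ∑ i, c i * x i :=
    Finset.sum_le_sum fun i _ => mul_le_mul_of_nonneg_right (hc i) (hx.1 i)
  rw [← Finset.mul_sum, hx.2] at h
  linarith

theorem volterra3_factors_nonneg {a12 a13 a14 a23 a24 a34 : ℝ}
    (h12 : a12 ∈ Set.Ioo (0 : ℝ) 1) (h13 : a13 ∈ Set.Ioo (0 : ℝ) 1)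
    (h14 : a14 ∈ Set.Ioo (0 : ℝ) 1) (h23 : a23 ∈ Set.Ioo (0 : ℝ) 1)
    (h24 : a24 ∈ Set.Ioo (0 : ℝ) 1) (h34 : a34 ∈ Set.Ioo (0 : ℝ) 1)
    {x : Fin 4 → ℝ} (hx : x ∈ simplex3) :
    0 ≤ 1 + (a12 * x 1 + a13 * x 2 + -a14 * x 3) ∧
    0 ≤ 1 + (-a12 * x 0 + a23 * x 2 + a24 * x 3) ∧
    0 ≤ 1 + (-a13 * x 0 + -a23 * x 1 + a34 * x 3) ∧
    0 ≤ 1 + (a14 * x 0 + -a24 * x 1 + -a34 * x 2) := by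
  simp only [Set.mem_Ioo] at h12 h13 h14 h23 h24 h34
  have k0 := one_add_nonneg_of_mem_simplex3 hx ![0, a12, a13, -a14]
    (by intro i; fin_cases i <;> simp <;> linarith)
  have k1 := one_add_nonneg_of_mem_simplex3 hx ![-a12, 0, a23, a24]
    (by intro i; fin_cases i <;> simp <;> linarith)
  have k2 := one_add_nonneg_of_mem_simplex3 hx ![-a13, -a23, 0, a34]
    (by intro i; fin_cases i <;> simp <;> linarith)
  have k3 := one_add_nonneg_of_mem_simplex3 hx ![a14, -a24, -a34, 0]
    (by intro i; fin_cases i <;> simp <;> linarith)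
  simp only [Fin.sum_univ_four, Matrix.cons_val] at k0 k1 k2 k3
  refine ⟨?_, ?_, ?_, ?_⟩ <;> linarith

theorem volterra3_mem_simplex3 {a12 a13 a14 a23 a24 a34 : ℝ}
    (h12 : a12 ∈ Set.Ioo (0 : ℝ) 1) (h13 : a13 ∈ Set.Ioo (0 : ℝ) 1)
    (h14 : a14 ∈ Set.Ioo (0 : ℝ) 1) (h23 : a23 ∈ Set.Ioo (0 : ℝ) 1)
    (h24 : a24 ∈ Set.Ioo (0 : ℝ) 1) (h34 : a34 ∈ Set.Ioo (0 : ℝ) 1)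
    {x : Fin 4 → ℝ} (hx : x ∈ simplex3) :
    volterra3 a12 a13 a14 a23 a24 a34 x ∈ simplex3 := by
  obtain ⟨k0, k1, k2, k3⟩ := volterra3_factors_nonneg h12 h13 h14 h23 h24 h34 hx
  refine ⟨fun i => ?_, ?_⟩
  · fin_cases i
    · exact mul_nonneg (hx.1 0) k0
    · exact mul_nonneg (hx.1 1) k1
    · exact mul_nonneg (hx.1 2) k2
    · exact mul_nonneg (hx.1 3) k3
  · have h := hx.2
    simp only [Fin.sum_univ_four] at h ⊢
    simp only [volterra3, Matrix.cons_val]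
    linear_combination h

theorem one_add_rpow_le_exp_mul {s p : ℝ} (hs : 0 ≤ 1 + s) (hp : 0 ≤ p) :
    (1 + s) ^ p ≤ Real.exp (s * p) := by
  rw [Real.exp_mul]
  exact Real.rpow_le_rpow hs (by linarith [Real.add_one_le_exp s]) hp

/-- If `I = -a₁₂a₃₄ + a₁₃a₂₄ + a₁₄a₂₃ ≥ 0`, then
`F(x) = x₁^{a₃₄} x₃^{a₁₄} x₄^{a₁₃}` (real powers) satisfies `F(Vx) ≤ F(x)` on `S³`;
in particular `n ↦ F(Vⁿ x)` is nonincreasing along every trajectory. -/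
theorem stmt_11 (a12 a13 a14 a23 a24 a34 : ℝ)
    (h12 : a12 ∈ Set.Ioo (0 : ℝ) 1) (h13 : a13 ∈ Set.Ioo (0 : ℝ) 1)
    (h14 : a14 ∈ Set.Ioo (0 : ℝ) 1) (h23 : a23 ∈ Set.Ioo (0 : ℝ) 1)
    (h24 : a24 ∈ Set.Ioo (0 : ℝ) 1) (h34 : a34 ∈ Set.Ioo (0 : ℝ) 1)
    (hI : 0 ≤ -a12 * a34 + a13 * a24 + a14 * a23)
    (F : (Fin 4 → ℝ) → ℝ)
    (hF : F = fun x => (x 0) ^ a34 * (x 2) ^ a14 * (x 3) ^ a13) :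
    (∀ x ∈ simplex3, F (volterra3 a12 a13 a14 a23 a24 a34 x) ≤ F x) ∧
    (∀ x ∈ simplex3,
      Antitone (fun n : ℕ => F ((volterra3 a12 a13 a14 a23 a24 a34)^[n] x))) := by
  have key : ∀ x ∈ simplex3, F (volterra3 a12 a13 a14 a23 a24 a34 x) ≤ F x := by
    intro x hx
    obtain ⟨k0, -, k2, k3⟩ := volterra3_factors_nonneg h12 h13 h14 h23 h24 h34 hx
    simp only [hF, volterra3, Matrix.cons_val]
    rw [Real.mul_rpow (hx.1 0) k0, Real.mul_rpow (hx.1 2) k2, Real.mul_rpow (hx.1 3) k3]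
    have e0 := one_add_rpow_le_exp_mul k0 h34.1.le
    have e2 := one_add_rpow_le_exp_mul k2 h14.1.le
    have e3 := one_add_rpow_le_exp_mul k3 h13.1.le
    have hprod := mul_le_mul (mul_le_mul e0 e2 (Real.rpow_nonneg k2 _) (Real.exp_nonneg _)) e3
      (Real.rpow_nonneg k3 _) (by positivity)
    rw [← Real.exp_add, ← Real.exp_add] at hprod
    have hone := hprod.trans (Real.exp_le_one_iff.2 (by linarith [mul_nonneg hI (hx.1 1)]))
    have hnonneg : 0 ≤ x 0 ^ a34 * x 2 ^ a14 * x 3 ^ a13 :=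
      mul_nonneg (mul_nonneg (Real.rpow_nonneg (hx.1 0) _) (Real.rpow_nonneg (hx.1 2) _))
        (Real.rpow_nonneg (hx.1 3) _)
    refine le_of_eq_of_le ?_ (mul_le_of_le_one_right hnonneg hone)
    ring
  refine ⟨key, fun x hx => antitone_nat_of_succ_le fun n => ?_⟩
  rw [Function.iterate_succ_apply']
  have hmaps : Set.MapsTo (volterra3 a12 a13 a14 a23 a24 a34) simplex3 simplex3 :=
    fun _ hy => volterra3_mem_simplex3 h12 h13 h14 h23 h24 h34 hy
  exact key _ (hmaps.iterate n hx)
end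

section
/- Let ε > 0 and x ∈ S³. If Vx ∈ U_ε, then x₂ ≤ ε/(1 − a₁₂), x₃ ≤ ε/(1 − max{a₁₃, a₂₃}) and x₄ ≤ ε/(1 − max{a₂₄, a₃₄}). -/
/-- The corner set `U_ε = {x ∈ S³ : x₂, x₃, x₄ ≤ ε}`. -/
def cornerSet (ε : ℝ) : Set (Fin 4 → ℝ) :=
  {x | x ∈ simplex3 ∧ x 1 ≤ ε ∧ x 2 ≤ ε ∧ x 3 ≤ ε}

/-- If the growth rate `L` is at least `-m > -1`, then `y` is controlled by `y * (1 + L)`. -/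
theorem le_div_one_sub_of_mul_one_add_le {y L m ε : ℝ} (hy : 0 ≤ y) (hm : m < 1)
    (hL : -m ≤ L) (h : y * (1 + L) ≤ ε) : y ≤ ε / (1 - m) := by
  rw [le_div_iff₀ (sub_pos.2 hm)]
  exact (mul_le_mul_of_nonneg_left (by linarith) hy).trans h

/-- A subconvex combination of `a` and `b` is at most `max a b`, if `a` is nonnegative. -/
theorem mul_add_mul_le_max {a b s t : ℝ} (ha : 0 ≤ a) (hs : 0 ≤ s) (ht : 0 ≤ t)
    (hst : s + t ≤ 1) : a * s + b * t ≤ max a b :=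
  calc a * s + b * t ≤ max a b * s + max a b * t := by gcongr <;> simp
    _ = max a b * (s + t) := by ring
    _ ≤ max a b := mul_le_of_le_one_right (ha.trans (le_max_left a b)) hst

/-- If `Vx ∈ U_ε` then `x₂ ≤ ε/(1-a₁₂)`, `x₃ ≤ ε/(1-max{a₁₃,a₂₃})`
and `x₄ ≤ ε/(1-max{a₂₄,a₃₄})`. -/
theorem stmt_14 (a12 a13 a14 a23 a24 a34 : ℝ)
    (h12 : a12 ∈ Set.Ioo (0 : ℝ) 1) (h13 : a13 ∈ Set.Ioo (0 : ℝ) 1)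
    (h14 : a14 ∈ Set.Ioo (0 : ℝ) 1) (h23 : a23 ∈ Set.Ioo (0 : ℝ) 1)
    (h24 : a24 ∈ Set.Ioo (0 : ℝ) 1) (h34 : a34 ∈ Set.Ioo (0 : ℝ) 1)
    (ε : ℝ) (hε : 0 < ε)
    (x : Fin 4 → ℝ) (hx : x ∈ simplex3)
    (hVx : volterra3 a12 a13 a14 a23 a24 a34 x ∈ cornerSet ε) :
    x 1 ≤ ε / (1 - a12) ∧
    x 2 ≤ ε / (1 - max a13 a23) ∧
    x 3 ≤ ε / (1 - max a24 a34) := by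
  obtain ⟨hx0, hsum⟩ := hx
  obtain ⟨-, h1, h2, h3⟩ := hVx
  rw [Fin.sum_univ_four] at hsum
  have p0 := hx0 0
  have p1 := hx0 1
  have p2 := hx0 2
  have p3 := hx0 3
  refine ⟨le_div_one_sub_of_mul_one_add_le p1 h12.2 ?_ h1,
    le_div_one_sub_of_mul_one_add_le p2 (max_lt h13.2 h23.2) ?_ h2,
    le_div_one_sub_of_mul_one_add_le p3 (max_lt h24.2 h34.2) ?_ h3⟩
  · have := mul_le_of_le_one_right h12.1.le (show x 0 ≤ 1 by linarith)
    have := mul_nonneg h23.1.le p2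
    have := mul_nonneg h24.1.le p3
    linarith
  · have := mul_add_mul_le_max (b := a23) h13.1.le p0 p1 (by linarith)
    have := mul_nonneg h34.1.le p3
    linarith
  · have := mul_add_mul_le_max (b := a34) h24.1.le p1 p2 (by linarith)
    have := mul_nonneg h14.1.le p0
    linarith
end

section
/- Let ε > 0 satisfy 5ε ≤ a₁₂ and 4ε ≤ a₁₃. Then for every y ∈ U_ε one has (Vy)₂ ≤ y₂ and (Vy)₃ ≤ y₃; in particular, while the trajectory stays in U_ε, the second and third coordinates do not increase. -/
/-- If `5ε ≤ a₁₂` and `4ε ≤ a₁₃`, then for every `y ∈ U_ε` one has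
`(Vy)₂ ≤ y₂` and `(Vy)₃ ≤ y₃`. -/
theorem stmt_15 (a12 a13 a14 a23 a24 a34 : ℝ)
    (h12 : a12 ∈ Set.Ioo (0 : ℝ) 1) (h13 : a13 ∈ Set.Ioo (0 : ℝ) 1)
    (h14 : a14 ∈ Set.Ioo (0 : ℝ) 1) (h23 : a23 ∈ Set.Ioo (0 : ℝ) 1)
    (h24 : a24 ∈ Set.Ioo (0 : ℝ) 1) (h34 : a34 ∈ Set.Ioo (0 : ℝ) 1)
    (ε : ℝ) (hε : 0 < ε) (hε12 : 5 * ε ≤ a12) (hε13 : 4 * ε ≤ a13) :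
    ∀ y ∈ cornerSet ε,
      volterra3 a12 a13 a14 a23 a24 a34 y 1 ≤ y 1 ∧
      volterra3 a12 a13 a14 a23 a24 a34 y 2 ≤ y 2 := by
  rintro y ⟨⟨hy, hsum⟩, h1, h2, h3⟩
  rw [Fin.sum_univ_four] at hsum
  have hy0 : 2 / 5 ≤ y 0 := by linarith [h12.2]
  have hlow12 : 2 * ε ≤ a12 * y 0 := by nlinarith [hy 0]
  have hlow13 : ε ≤ a13 * y 0 := by nlinarith [hy 0]
  have hup23 : a23 * y 2 ≤ ε := (mul_le_of_le_one_left (hy 2) h23.2.le).trans h2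
  have hup24 : a24 * y 3 ≤ ε := (mul_le_of_le_one_left (hy 3) h24.2.le).trans h3
  have hup34 : a34 * y 3 ≤ ε := (mul_le_of_le_one_left (hy 3) h34.2.le).trans h3
  have hpos23 : 0 ≤ a23 * y 1 := mul_nonneg h23.1.le (hy 1)
  constructor
  · change y 1 * (1 + (-a12 * y 0 + a23 * y 2 + a24 * y 3)) ≤ y 1
    exact mul_le_of_le_one_right (hy 1) (by linarith)
  · change y 2 * (1 + (-a13 * y 0 + -a23 * y 1 + a34 * y 3)) ≤ y 2
    exact mul_le_of_le_one_right (hy 2) (by linarith)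
end

section
/- The operator V is not ergodic: there exist a continuous function f : S³ → ℝ and a point x in the interior of S³ such that the Cesàro averages (1/k) ∑_{n=0}^{k-1} f(Vⁿx) do not converge as k → ∞. -/
open Filter Topology Set Finset

/-- The sequence `u` has Cesàro mean `L`. -/
def HasCesaroMean (u : ℕ → ℝ) (L : ℝ) : Prop :=
  Tendsto (fun k : ℕ => (1 / (k : ℝ)) * ∑ n ∈ range k, u n) atTop (𝓝 L)

namespace HasCesaroMean

variable {u v : ℕ → ℝ} {a b : ℝ}

lemma add (hu : HasCesaroMean u a) (hv : HasCesaroMean v b) :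
    HasCesaroMean (fun n => u n + v n) (a + b) := by
  refine (Tendsto.add hu hv).congr fun k => ?_
  rw [sum_add_distrib, mul_add]

lemma const_mul (c : ℝ) (hu : HasCesaroMean u a) :
    HasCesaroMean (fun n => c * u n) (c * a) := by
  refine (Tendsto.const_mul c hu).congr fun k => ?_
  rw [← mul_sum]; ring

lemma of_tendsto (hu : Tendsto u atTop (𝓝 a)) : HasCesaroMean u a := by
  simpa [HasCesaroMean] using hu.cesaro

lemma const (c : ℝ) : HasCesaroMean (fun _ => c) c := of_tendsto tendsto_const_nhds

lemma sum {ι : Type*} (s : Finset ι) {u : ι → ℕ → ℝ} {a : ι → ℝ}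
    (h : ∀ i ∈ s, HasCesaroMean (u i) (a i)) :
    HasCesaroMean (fun n => ∑ i ∈ s, u i n) (∑ i ∈ s, a i) := by
  refine (tendsto_finsetSum s h).congr fun k => ?_
  rw [sum_comm, mul_sum]

lemma le (hu : HasCesaroMean u a) (hv : HasCesaroMean v b) (h : ∀ n, u n ≤ v n) : a ≤ b :=
  le_of_tendsto_of_tendsto' hu hv fun k => by
    have := sum_le_sum fun n (_ : n ∈ range k) => h n
    gcongr

lemma unique (hu : HasCesaroMean u a) (hv : HasCesaroMean u b) : a = b :=
  tendsto_nhds_unique hu hv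

lemma frequently_lt (hu : HasCesaroMean u a) {ε : ℝ} (hε : a < ε) : ∃ᶠ n in atTop, u n < ε := by
  intro h
  have h' : ∀ᶠ n in atTop, ε ≤ u n := h.mono fun n hn => not_lt.1 hn
  have hmin : Tendsto (fun n => min (u n) ε) atTop (𝓝 ε) :=
    tendsto_const_nhds.congr' (h'.mono fun n hn => (min_eq_right hn).symm)
  exact absurd ((of_tendsto hmin).le hu fun n => min_le_left _ _) (not_le.2 hε)

end HasCesaroMean

/-- A continuous function vanishing at a single point of a compact set detects averages there. -/
lemma HasCesaroMean.comp_of_unique_zero {X : Type*} [TopologicalSpace X] {K : Set X}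
    (hK : IsCompact K) {h g : X → ℝ} (hh : ContinuousOn h K) (hg : ContinuousOn g K)
    (h0 : ∀ x ∈ K, 0 ≤ h x) {z : X} (hz : ∀ x ∈ K, h x = 0 → x = z) {y : ℕ → X}
    (hy : ∀ n, y n ∈ K) (hmean : HasCesaroMean (fun n => h (y n)) 0) {L : ℝ}
    (hL : HasCesaroMean (fun n => g (y n)) L) : L = g z := by
  have key : ∀ ε > 0, |L - g z| ≤ ε := by
    intro ε hε
    obtain ⟨C, hC⟩ : ∃ C, ∀ x ∈ K, |g x - g z| ≤ ε + C * h x := by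
      have hcont : ContinuousOn (fun x => |g x - g z|) K := (hg.sub continuousOn_const).abs
      obtain ⟨M, hM⟩ := hK.bddAbove_image hcont
      have hM' : ∀ x ∈ K, |g x - g z| ≤ M := fun x hx => hM (mem_image_of_mem _ hx)
      have hK' : IsCompact (K ∩ (fun x => |g x - g z|) ⁻¹' Ici ε) := by
        obtain ⟨t, ht, hte⟩ := continuousOn_iff_isClosed.1 hcont (Ici ε) isClosed_Ici
        rw [inter_comm, hte, inter_comm]
        exact hK.inter_right ht
      rcases (K ∩ (fun x => |g x - g z|) ⁻¹' Ici ε).eq_empty_or_nonempty with he | hne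
      · refine ⟨0, fun x hx => ?_⟩
        by_contra! hcon
        have : x ∈ K ∩ (fun x => |g x - g z|) ⁻¹' Ici ε := ⟨hx, by simp at hcon ⊢; linarith⟩
        rw [he] at this
        exact this
      · obtain ⟨w, hw, hwmin⟩ := hK'.exists_isMinOn hne (hh.mono inter_subset_left)
        have hwpos : 0 < h w := by
          refine lt_of_le_of_ne (h0 w hw.1) fun h' => ?_
          have := hz w hw.1 h'.symm
          have h2 := hw.2
          simp [this] at h2
          linarith
        have hMpos : 0 ≤ M := (abs_nonneg _).trans (hM' w hw.1)
        refine ⟨M / h w, fun x hx => ?_⟩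
        by_cases hxe : ε ≤ |g x - g z|
        · have h1 : h w ≤ h x := hwmin ⟨hx, hxe⟩
          have h2 : M ≤ M / h w * h x := by
            rw [div_mul_eq_mul_div, le_div_iff₀ hwpos]; gcongr
          linarith [hM' x hx]
        · have : 0 ≤ M / h w * h x := mul_nonneg (by positivity) (h0 x hx)
          linarith
    have h1 : HasCesaroMean (fun n => ε + C * h (y n)) (ε + C * 0) :=
      (const ε).add (hmean.const_mul C)
    have h2 : HasCesaroMean (fun n => g (y n) + -g z) (L + -g z) := hL.add (const _)
    have h3 := h2.le h1 fun n => (by linarith [(abs_le.1 (hC _ (hy n))).2])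
    have h4 := (h1.const_mul (-1)).le h2 fun n => (by linarith [(abs_le.1 (hC _ (hy n))).1])
    exact abs_le.2 ⟨by linarith, by linarith⟩
  have : |L - g z| ≤ 0 := le_of_forall_pos_le_add fun ε hε => by simpa using key ε hε
  linarith [abs_nonpos_iff.1 this]

lemma Real.log_one_add_le_sub_sq {t : ℝ} (h1 : -1 < t) (h2 : t < 1) :
    Real.log (1 + t) ≤ t - t ^ 2 / 6 := by
  set s := √(1 + t) with hs
  have hs0 : 0 < s := Real.sqrt_pos.2 (by linarith)
  have hsq : s ^ 2 = 1 + t := Real.sq_sqrt (by linarith)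
  have hlog : Real.log (1 + t) = 2 * Real.log s := by rw [← hsq, Real.log_pow]; norm_num
  have h := Real.log_le_sub_one_of_pos hs0
  have hs3 : s < 1.42 := by nlinarith
  have h6 : (s + 1) ^ 2 ≤ 6 := by nlinarith
  have ht : t = s ^ 2 - 1 := by linarith
  have h7 : 0 ≤ (s - 1) ^ 2 * (6 - (s + 1) ^ 2) := mul_nonneg (sq_nonneg _) (by linarith)
  rw [hlog, ht]
  nlinarith

/-- The Volterra operator attached to a square matrix. -/
def volterraMap {ι : Type*} [Fintype ι] (A : Matrix ι ι ℝ) (x : ι → ℝ) : ι → ℝ :=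
  fun k => x k * (1 + (A.mulVec x) k)

section Volterra

variable {ι : Type*} [Fintype ι] {A : Matrix ι ι ℝ}

lemma dotProduct_mulVec_skew (hA : A.transpose = -A) (x y : ι → ℝ) :
    x ⬝ᵥ A.mulVec y = -(y ⬝ᵥ A.mulVec x) := by
  rw [Matrix.dotProduct_mulVec, ← Matrix.mulVec_transpose, hA, Matrix.neg_mulVec,
    neg_dotProduct, dotProduct_comm]

lemma dotProduct_mulVec_self (hA : A.transpose = -A) (x : ι → ℝ) :
    x ⬝ᵥ A.mulVec x = 0 := by
  linarith [dotProduct_mulVec_skew hA x x]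

lemma sum_volterraMap (hA : A.transpose = -A) (x : ι → ℝ) :
    ∑ k, volterraMap A x k = ∑ k, x k := by
  have := dotProduct_mulVec_self hA x
  simp only [dotProduct] at this
  simp only [volterraMap, mul_add, mul_one, sum_add_distrib, this, add_zero]

lemma abs_mulVec_lt_one (hlt : ∀ i j, |A i j| < 1) {x : ι → ℝ} (hx : x ∈ stdSimplex ℝ ι) (k : ι) :
    |A.mulVec x k| < 1 := by
  obtain ⟨h0, h1⟩ := hx
  obtain ⟨i, -, hi⟩ : ∃ i ∈ Finset.univ, 0 < x i := by
    by_contra! h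
    have := sum_nonpos h
    linarith
  calc |A.mulVec x k| ≤ ∑ j, |A k j * x j| := abs_sum_le_sum_abs _ _
    _ < ∑ j, x j := by
      refine sum_lt_sum (fun j _ => ?_) ⟨i, Finset.mem_univ i, ?_⟩
      · rw [abs_mul, abs_of_nonneg (h0 j)]
        exact mul_le_of_le_one_left (h0 j) (hlt k j).le
      · rw [abs_mul, abs_of_pos hi]
        exact mul_lt_of_lt_one_left hi (hlt k i)
    _ = 1 := h1

lemma one_add_mulVec_pos (hlt : ∀ i j, |A i j| < 1) {x : ι → ℝ} (hx : x ∈ stdSimplex ℝ ι) (k : ι) :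
    0 < 1 + A.mulVec x k := by
  linarith [(abs_lt.1 (abs_mulVec_lt_one hlt hx k)).1]

/-- The relative interior of the standard simplex. -/
def openSimplex (ι : Type*) [Fintype ι] : Set (ι → ℝ) := {x | (∀ i, 0 < x i) ∧ ∑ i, x i = 1}

lemma openSimplex_subset : openSimplex ι ⊆ stdSimplex ℝ ι := fun _ hx => ⟨fun i => (hx.1 i).le, hx.2⟩

lemma volterraMap_mem_openSimplex (hA : A.transpose = -A) (hlt : ∀ i j, |A i j| < 1) {x : ι → ℝ}
    (hx : x ∈ openSimplex ι) : volterraMap A x ∈ openSimplex ι :=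
  ⟨fun k => mul_pos (hx.1 k) (one_add_mulVec_pos hlt (openSimplex_subset hx) k),
    (sum_volterraMap hA x).trans hx.2⟩

lemma iterate_volterraMap_mem (hA : A.transpose = -A) (hlt : ∀ i j, |A i j| < 1) {x : ι → ℝ}
    (hx : x ∈ openSimplex ι) (n : ℕ) : (volterraMap A)^[n] x ∈ openSimplex ι := by
  induction n with
  | zero => exact hx
  | succ n ih => rw [Function.iterate_succ_apply']; exact volterraMap_mem_openSimplex hA hlt ih

lemma continuous_mulVec_apply (k : ι) : Continuous fun x : ι → ℝ => A.mulVec x k := by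
  unfold Matrix.mulVec dotProduct
  fun_prop

lemma continuous_volterraMap : Continuous (volterraMap A) :=
  continuous_pi fun k => (continuous_apply k).mul (continuous_const.add (continuous_mulVec_apply k))

lemma log_iterate_volterraMap (hA : A.transpose = -A) (hlt : ∀ i j, |A i j| < 1) {x : ι → ℝ}
    (hx : x ∈ openSimplex ι) (k : ι) (n : ℕ) :
    Real.log ((volterraMap A)^[n] x k) =
      Real.log (x k) + ∑ l ∈ range n, Real.log (1 + A.mulVec ((volterraMap A)^[l] x) k) := by
  induction n with
  | zero => simp
  | succ n ih =>
    have hn := iterate_volterraMap_mem hA hlt hx n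
    rw [Function.iterate_succ_apply', sum_range_succ, ← add_assoc, ← ih, volterraMap,
      Real.log_mul (hn.1 k).ne' (one_add_mulVec_pos hlt (openSimplex_subset hn) k).ne']

/-- All time averages of continuous functions along the orbit of `x` converge. -/
def ErgodicAt (A : Matrix ι ι ℝ) (x : ι → ℝ) : Prop :=
  ∀ f : (ι → ℝ) → ℝ, ContinuousOn f (stdSimplex ℝ ι) →
    ∃ L, HasCesaroMean (fun n => f ((volterraMap A)^[n] x)) L

lemma continuousOn_log_one_add_mulVec (hlt : ∀ i j, |A i j| < 1) (k : ι) :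
    ContinuousOn (fun x => Real.log (1 + A.mulVec x k)) (stdSimplex ℝ ι) :=
  ContinuousOn.log (continuous_const.add (continuous_mulVec_apply k)).continuousOn
    fun _ hx => (one_add_mulVec_pos hlt hx k).ne'

lemma mean_log_nonpos (hA : A.transpose = -A) (hlt : ∀ i j, |A i j| < 1) {x : ι → ℝ}
    (hx : x ∈ openSimplex ι) {k : ι} {l : ℝ}
    (hl : HasCesaroMean (fun n => Real.log (1 + A.mulVec ((volterraMap A)^[n] x) k)) l) :
    l ≤ 0 := by
  have h0 : Tendsto (fun n : ℕ => (1 / (n : ℝ)) * -Real.log (x k)) atTop (𝓝 (0 * -Real.log (x k))) :=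
    tendsto_one_div_atTop_nhds_zero_nat.mul_const _
  rw [zero_mul] at h0
  refine le_of_tendsto_of_tendsto' hl h0 fun n => ?_
  have hn := iterate_volterraMap_mem hA hlt hx n
  have h1 := log_iterate_volterraMap hA hlt hx k n
  have h2 : Real.log ((volterraMap A)^[n] x k) ≤ 0 :=
    Real.log_nonpos (hn.1 k).le (by
      rw [← hn.2]; exact single_le_sum (fun i _ => (hn.1 i).le) (Finset.mem_univ k))
  gcongr
  linarith

lemma summable_of_mean_log_neg (hA : A.transpose = -A) (hlt : ∀ i j, |A i j| < 1) {x : ι → ℝ}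
    (hx : x ∈ openSimplex ι) {k : ι} {l : ℝ}
    (hl : HasCesaroMean (fun n => Real.log (1 + A.mulVec ((volterraMap A)^[n] x) k)) l)
    (hneg : l < 0) : Summable fun n => (volterraMap A)^[n] x k := by
  have h1 : ∀ᶠ n : ℕ in atTop, (volterraMap A)^[n] x k ≤ x k * Real.exp (n * (l / 2)) := by
    filter_upwards [(tendsto_order.1 hl).2 (l / 2) (by linarith), eventually_gt_atTop 0]
      with n hn hn0
    have hm := iterate_volterraMap_mem hA hlt hx n
    have hn0' : (0 : ℝ) < n := by exact_mod_cast hn0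
    rw [← Real.log_le_log_iff (hm.1 k) (mul_pos (hx.1 k) (Real.exp_pos _)),
      Real.log_mul (hx.1 k).ne' (Real.exp_pos _).ne', Real.log_exp,
      log_iterate_volterraMap hA hlt hx k n]
    rw [one_div, inv_mul_lt_iff₀ hn0'] at hn
    linarith
  have h2 : Summable fun n : ℕ => x k * Real.exp (n * (l / 2)) :=
    (Real.summable_exp_nat_mul_iff.2 (by linarith)).mul_left _
  refine Summable.of_norm_bounded_eventually_nat h2 ?_
  filter_upwards [h1] with n hn
  rwa [Real.norm_of_nonneg ((iterate_volterraMap_mem hA hlt hx n).1 k).le]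

/-- Vanishes exactly at the points of the face spanned by the support of `m` that are annihilated
by the corresponding rows of `A`. -/
noncomputable def faceDefect (A : Matrix ι ι ℝ) (m y : ι → ℝ) : ℝ :=
  ∑ i, if 0 < m i then (A.mulVec y i) ^ 2 else y i

lemma continuous_faceDefect (m : ι → ℝ) : Continuous (faceDefect A m) := by
  refine continuous_finsetSum _ fun i _ => ?_
  split_ifs
  · exact (continuous_mulVec_apply i).pow 2
  · exact continuous_apply i

lemma faceDefect_summand_nonneg {m y : ι → ℝ} (hy : y ∈ stdSimplex ℝ ι) (i : ι) :
    0 ≤ if 0 < m i then (A.mulVec y i) ^ 2 else y i := by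
  split_ifs
  · positivity
  · exact hy.1 i

lemma faceDefect_nonneg {m y : ι → ℝ} (hy : y ∈ stdSimplex ℝ ι) : 0 ≤ faceDefect A m y :=
  sum_nonneg fun i _ => faceDefect_summand_nonneg hy i

lemma faceDefect_eq_zero {m y : ι → ℝ} (hy : y ∈ stdSimplex ℝ ι) (h : faceDefect A m y = 0) (i : ι) :
    (0 < m i → A.mulVec y i = 0) ∧ (¬ 0 < m i → y i = 0) := by
  have := (sum_eq_zero_iff_of_nonneg fun i _ => faceDefect_summand_nonneg hy i).1 h i
    (Finset.mem_univ i)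
  constructor <;> intro hi <;> simpa [hi] using this

lemma exists_mean (hA : A.transpose = -A) (hlt : ∀ i j, |A i j| < 1) {x : ι → ℝ}
    (hx : x ∈ openSimplex ι) (herg : ErgodicAt A x) :
    ∃ m ∈ stdSimplex ℝ ι, (∀ i, 0 < m i → A.mulVec m i = 0) ∧
      HasCesaroMean (fun n => faceDefect A m ((volterraMap A)^[n] x)) 0 := by
  have hmem := fun n => openSimplex_subset (iterate_volterraMap_mem hA hlt hx n)
  choose m hm using fun i => herg (fun y => y i) (continuous_apply i).continuousOn
  choose l hl using fun k => herg _ (continuousOn_log_one_add_mulVec hlt k)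
  choose q hq using fun k => herg (fun y => (A.mulVec y k) ^ 2)
    ((continuous_mulVec_apply k).pow 2).continuousOn
  have hm0 : ∀ i, 0 ≤ m i := fun i => (HasCesaroMean.const 0).le (hm i) fun n => (hmem n).1 i
  have hm1 : ∑ i, m i = 1 :=
    (HasCesaroMean.sum univ fun i _ => hm i).unique
      (by simpa only [(hmem _).2] using HasCesaroMean.const 1)
  have hAm : ∀ k, HasCesaroMean (fun n => A.mulVec ((volterraMap A)^[n] x) k) (A.mulVec m k) :=
    fun k => HasCesaroMean.sum univ fun j _ => (hm j).const_mul (A k j)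
  have hq0 : ∀ k, 0 ≤ q k := fun k => (HasCesaroMean.const 0).le (hq k) fun n => sq_nonneg _
  have hml : ∀ k, m k * l k = 0 := by
    intro k
    rcases (mean_log_nonpos hA hlt hx (hl k)).eq_or_lt with h | h
    · rw [h, mul_zero]
    · rw [(hm k).unique (HasCesaroMean.of_tendsto
        (summable_of_mean_log_neg hA hlt hx (hl k) h).tendsto_atTop_zero), zero_mul]
  have hlq : ∀ k, l k ≤ A.mulVec m k + -(1 / 6) * q k := fun k =>
    (hl k).le ((hAm k).add ((hq k).const_mul (-(1 / 6)))) fun n => by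
      have h := abs_lt.1 (abs_mulVec_lt_one hlt (hmem n) k)
      linarith [Real.log_one_add_le_sub_sq h.1 h.2]
  have hsum : ∑ k, m k * q k ≤ 0 := by
    have h1 : ∑ k, m k * l k ≤ ∑ k, m k * (A.mulVec m k + -(1 / 6) * q k) :=
      sum_le_sum fun k _ => mul_le_mul_of_nonneg_left (hlq k) (hm0 k)
    have h2 := dotProduct_mulVec_self hA m
    simp only [dotProduct] at h2
    simp only [hml, sum_const_zero, mul_add, sum_add_distrib, h2, zero_add] at h1
    have h3 : ∑ k, m k * (-(1 / 6) * q k) = -(1 / 6) * ∑ k, m k * q k := by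
      rw [mul_sum]; exact sum_congr rfl fun k _ => by ring
    linarith
  have hmq : ∀ k, 0 < m k → q k = 0 := by
    intro k hk
    have h1 := single_le_sum (fun i _ => mul_nonneg (hm0 i) (hq0 i)) (Finset.mem_univ k)
    have h2 := hq0 k
    by_contra hne
    have := mul_pos hk (lt_of_le_of_ne h2 (Ne.symm hne))
    linarith
  refine ⟨m, ⟨hm0, hm1⟩, fun i hi => ?_, ?_⟩
  · set a := A.mulVec m i with ha
    have h1 := (hq i).add (((hAm i).const_mul (-(2 * a))).add (HasCesaroMean.const (a ^ 2)))
    have h2 := (HasCesaroMean.const 0).le h1 fun n => by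
      nlinarith [sq_nonneg (A.mulVec ((volterraMap A)^[n] x) i - a)]
    rw [hmq i hi] at h2
    have : a ^ 2 ≤ 0 := by linarith
    exact pow_eq_zero_iff two_ne_zero |>.1 (le_antisymm this (sq_nonneg a))
  · have h := HasCesaroMean.sum univ (u := fun i n => if 0 < m i then
      (A.mulVec ((volterraMap A)^[n] x) i) ^ 2 else ((volterraMap A)^[n] x) i)
      (a := fun _ => 0) fun i _ => by
        split_ifs with hi
        · simpa [hmq i hi] using hq i
        · simpa [le_antisymm (not_lt.1 hi) (hm0 i)] using hm i
    simpa [faceDefect] using h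

lemma mean_log_of_unique (hA : A.transpose = -A) (hlt : ∀ i j, |A i j| < 1) {x m : ι → ℝ}
    (hx : x ∈ openSimplex ι) (herg : ErgodicAt A x)
    (hm : HasCesaroMean (fun n => faceDefect A m ((volterraMap A)^[n] x)) 0)
    (huniq : ∀ y ∈ stdSimplex ℝ ι, faceDefect A m y = 0 → y = m) (k : ι) :
    HasCesaroMean (fun n => Real.log (1 + A.mulVec ((volterraMap A)^[n] x) k))
      (Real.log (1 + A.mulVec m k)) := by
  obtain ⟨l, hl⟩ := herg _ (continuousOn_log_one_add_mulVec hlt k)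
  have := HasCesaroMean.comp_of_unique_zero (isCompact_stdSimplex ℝ ι)
    (continuous_faceDefect m).continuousOn (continuousOn_log_one_add_mulVec hlt k)
    (fun y hy => faceDefect_nonneg hy) huniq
    (fun n => openSimplex_subset (iterate_volterraMap_mem hA hlt hx n)) hm hl
  rwa [← this]

lemma mulVec_nonpos_of_unique (hA : A.transpose = -A) (hlt : ∀ i j, |A i j| < 1) {x m : ι → ℝ}
    (hx : x ∈ openSimplex ι) (herg : ErgodicAt A x)
    (hm : HasCesaroMean (fun n => faceDefect A m ((volterraMap A)^[n] x)) 0)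
    (huniq : ∀ y ∈ stdSimplex ℝ ι, faceDefect A m y = 0 → y = m) (k : ι) :
    A.mulVec m k ≤ 0 := by
  have h1 := mean_log_nonpos hA hlt hx (mean_log_of_unique hA hlt hx herg hm huniq k)
  by_contra! h
  exact absurd (Real.log_pos (by linarith : 1 < 1 + A.mulVec m k)) (not_lt.2 h1)

lemma exists_subseq_tendsto (hA : A.transpose = -A) (hlt : ∀ i j, |A i j| < 1) {x m : ι → ℝ}
    (hx : x ∈ openSimplex ι)
    (hm : HasCesaroMean (fun n => faceDefect A m ((volterraMap A)^[n] x)) 0) :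
    ∃ y ∈ stdSimplex ℝ ι, faceDefect A m y = 0 ∧ ∃ φ : ℕ → ℕ, StrictMono φ ∧
      Tendsto (fun n => (volterraMap A)^[φ n] x) atTop (𝓝 y) := by
  have hmem := fun n => openSimplex_subset (iterate_volterraMap_mem hA hlt hx n)
  obtain ⟨φ, hφ, hφ'⟩ := extraction_forall_of_frequently
    (fun N : ℕ => hm.frequently_lt (ε := 1 / ((N : ℝ) + 1)) (by positivity))
  obtain ⟨y, hy, θ, hθ, hlim⟩ := (isCompact_stdSimplex ℝ ι).tendsto_subseq fun n => hmem (φ n)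
  refine ⟨y, hy, le_antisymm ?_ (faceDefect_nonneg hy), φ ∘ θ, hφ.comp hθ, hlim⟩
  exact le_of_tendsto_of_tendsto' (((continuous_faceDefect m).tendsto y).comp hlim)
    (tendsto_one_div_add_atTop_nhds_zero_nat.comp hθ.tendsto_atTop) fun n => (hφ' (θ n)).le

/-- The weighted geometric mean of the coordinates of `x`. -/
noncomputable def geomMean (z x : ι → ℝ) : ℝ := ∏ i, x i ^ z i

lemma continuous_geomMean {z : ι → ℝ} (hz : ∀ i, 0 ≤ z i) : Continuous (geomMean z) :=
  continuous_finsetProd _ fun i _ => (continuous_apply i).rpow_const fun _ => Or.inr (hz i)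

lemma geomMean_nonneg {z x : ι → ℝ} (hx : ∀ i, 0 ≤ x i) : 0 ≤ geomMean z x :=
  prod_nonneg fun i _ => Real.rpow_nonneg (hx i) _

lemma geomMean_volterraMap_le (hA : A.transpose = -A) (hlt : ∀ i j, |A i j| < 1) {x z : ι → ℝ}
    (hx : x ∈ stdSimplex ℝ ι) (hz : z ∈ stdSimplex ℝ ι) :
    geomMean z (volterraMap A x) ≤ geomMean z x * (1 - x ⬝ᵥ A.mulVec z) := by
  have h0 := fun k => (one_add_mulVec_pos hlt hx k).le
  have h1 : geomMean z (volterraMap A x) = geomMean z x * ∏ i, (1 + A.mulVec x i) ^ z i := by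
    simp only [geomMean, volterraMap]
    rw [← prod_mul_distrib]
    exact prod_congr rfl fun i _ => Real.mul_rpow (hx.1 i) (h0 i)
  have h2 := Real.geom_mean_le_arith_mean_weighted univ z (fun i => 1 + A.mulVec x i)
    (fun i _ => hz.1 i) hz.2 fun i _ => h0 i
  have h3 : ∑ i, z i * (1 + A.mulVec x i) = 1 - x ⬝ᵥ A.mulVec z := by
    rw [dotProduct_mulVec_skew hA x z]
    simp only [mul_add, mul_one, sum_add_distrib, hz.2, dotProduct]
    ring
  rw [h1, ← h3]
  exact mul_le_mul_of_nonneg_left h2 (geomMean_nonneg hx.1)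

lemma eq_of_geomMean_le {x z : ι → ℝ} (hx : x ∈ stdSimplex ℝ ι) (hz : z ∈ stdSimplex ℝ ι)
    (h : geomMean z z ≤ geomMean z x) : x = z := by
  have hpos : 0 < geomMean z z := prod_pos fun i _ => by
    rcases (hz.1 i).eq_or_lt with hi | hi
    · simp [← hi]
    · exact Real.rpow_pos_of_pos hi _
  have h1 : 1 ≤ ∏ i, (x i / z i) ^ z i := by
    simp only [fun i => Real.div_rpow (hx.1 i) (hz.1 i) (z i), prod_div_distrib]
    exact (one_le_div hpos).2 h
  have hle : ∀ i, z i * (x i / z i) ≤ x i := fun i => by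
    rcases (hz.1 i).eq_or_lt with hi | hi
    · simpa [← hi] using hx.1 i
    · rw [mul_div_cancel₀ _ hi.ne']
  have h2 : ∑ i, z i * (x i / z i) ≤ 1 := (sum_le_sum fun i _ => hle i).trans hx.2.le
  have h0 : ∀ i ∈ (univ : Finset ι), 0 ≤ x i / z i := fun i _ => div_nonneg (hx.1 i) (hz.1 i)
  have h3 := Real.geom_mean_le_arith_mean_weighted univ z (fun i => x i / z i)
    (fun i _ => hz.1 i) hz.2 h0
  have h4 := (Real.geom_mean_eq_arith_mean_weighted_iff_of_nonneg' univ z (fun i => x i / z i)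
    (fun i _ => hz.1 i) hz.2 h0).1 (by linarith)
  have h5 : ∑ i, z i * (x i / z i) = 1 := by linarith
  have h6 : ∀ i ∈ (univ : Finset ι), z i * (x i / z i) = x i :=
    (sum_eq_sum_iff_of_le fun i _ => hle i).1 (h5.trans hx.2.symm)
  funext i
  rw [← h6 i (Finset.mem_univ i)]
  by_cases hi : z i = 0
  · simp [hi]
  · rw [h4 i (Finset.mem_univ i) hi, h5, mul_one]

/-- If `A z` is supported in a coordinate which is summable along the orbit, an orbit accumulating
at `z` converges to `z`. -/
lemma tendsto_of_subseq (hA : A.transpose = -A) (hlt : ∀ i j, |A i j| < 1) {x z : ι → ℝ}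
    (hx : x ∈ openSimplex ι) (hz : z ∈ stdSimplex ℝ ι) {j : ι} (hAz : ∀ i, i ≠ j → A.mulVec z i = 0)
    (hsum : Summable fun n => (volterraMap A)^[n] x j) {φ : ℕ → ℕ} (hφ : StrictMono φ)
    (hlim : Tendsto (fun n => (volterraMap A)^[φ n] x) atTop (𝓝 z)) :
    Tendsto (fun n => (volterraMap A)^[n] x) atTop (𝓝 z) := by
  have hmem := fun n => openSimplex_subset (iterate_volterraMap_mem hA hlt hx n)
  set y : ℕ → ι → ℝ := fun n => (volterraMap A)^[n] x with hy
  have hcont := continuous_geomMean hz.1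
  set G : ℕ → ℝ := fun n => geomMean z (y n) with hG
  have hG0 : ∀ n, 0 ≤ G n := fun n => geomMean_nonneg (hmem n).1
  have hG1 : ∀ n, G n ≤ 1 := fun n => prod_le_one (fun i _ => Real.rpow_nonneg ((hmem n).1 i) _)
    fun i _ => Real.rpow_le_one ((hmem n).1 i) (by
      rw [← (hmem n).2]; exact single_le_sum (fun i _ => (hmem n).1 i) (Finset.mem_univ i)) (hz.1 i)
  set S : ℕ → ℝ := fun n => ∑ l ∈ range n, y l j with hS
  have hstep : ∀ n, G (n + 1) ≤ G n + |A.mulVec z j| * y n j := by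
    intro n
    have h1 := geomMean_volterraMap_le hA hlt (hmem n) hz
    have h2 : y n ⬝ᵥ A.mulVec z = y n j * A.mulVec z j :=
      sum_eq_single j (fun i _ hi => by rw [hAz i hi, mul_zero]) (by simp)
    have h3 : G (n + 1) = geomMean z (volterraMap A (y n)) := by
      simp only [hG, hy, Function.iterate_succ_apply']
    have h4 : -(G n * (y n j * A.mulVec z j)) ≤ |A.mulVec z j| * y n j := by
      calc -(G n * (y n j * A.mulVec z j)) ≤ |G n * (y n j * A.mulVec z j)| := neg_le_abs _
        _ = G n * (|A.mulVec z j| * y n j) := by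
          rw [abs_mul, abs_mul, abs_of_nonneg (hG0 n), abs_of_nonneg ((hmem n).1 j)]; ring
        _ ≤ _ := mul_le_of_le_one_left (mul_nonneg (abs_nonneg _) ((hmem n).1 j)) (hG1 n)
    have h5 : geomMean z (volterraMap A (y n)) ≤ G n * (1 - y n j * A.mulVec z j) := by
      rw [← h2]; exact h1
    rw [h3]; linarith
  have hSlim : Tendsto S atTop (𝓝 (∑' n, y n j)) := hsum.hasSum.tendsto_sum_nat
  have hSle : ∀ n, S n ≤ ∑' n, y n j := fun n => hsum.sum_le_tsum _ fun l _ => (hmem l).1 j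
  have hanti : Antitone fun n => G n - |A.mulVec z j| * S n := antitone_nat_of_succ_le fun n => by
    have := hstep n
    simp only [hS, sum_range_succ, mul_add] at this ⊢
    linarith
  have hbdd : BddBelow (Set.range fun n => G n - |A.mulVec z j| * S n) := by
    refine ⟨-(|A.mulVec z j| * ∑' n, y n j), ?_⟩
    rintro _ ⟨n, rfl⟩
    have := mul_le_mul_of_nonneg_left (hSle n) (abs_nonneg (A.mulVec z j))
    have := hG0 n
    dsimp only
    linarith
  have hGlim := (tendsto_atTop_ciInf hanti hbdd).add (hSlim.const_mul |A.mulVec z j|)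
  simp only [sub_add_cancel] at hGlim
  have hGz := tendsto_nhds_unique (hGlim.comp hφ.tendsto_atTop) ((hcont.tendsto z).comp hlim)
  rw [hGz] at hGlim
  refine (isCompact_stdSimplex ℝ ι).le_nhds_of_unique_clusterPt
    (mem_map.2 (Eventually.of_forall hmem)) fun w hw hcl => ?_
  refine eq_of_geomMean_le hw hz (le_of_eq ?_)
  have hcl' : MapClusterPt (geomMean z w) atTop G :=
    MapClusterPt.continuousAt_comp hcont.continuousAt hcl
  exact (eq_of_nhds_neBot (ClusterPt.mono hcl' hGlim)).symm

lemma eq_of_subseq_of_mulVec_eq_zero (hA : A.transpose = -A) (hlt : ∀ i j, |A i j| < 1)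
    {x z : ι → ℝ} (hx : x ∈ openSimplex ι) (hz : z ∈ stdSimplex ℝ ι) (hAz : A.mulVec z = 0)
    {φ : ℕ → ℕ}
    (hlim : Tendsto (fun n => (volterraMap A)^[φ n] x) atTop (𝓝 z)) : x = z := by
  have hmem := fun n => openSimplex_subset (iterate_volterraMap_mem hA hlt hx n)
  have hanti : Antitone fun n => geomMean z ((volterraMap A)^[n] x) :=
    antitone_nat_of_succ_le fun n => by
      have := geomMean_volterraMap_le hA hlt (hmem n) hz
      rw [Function.iterate_succ_apply']
      simpa [hAz] using this
  exact eq_of_geomMean_le (openSimplex_subset hx) hz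
    (le_of_tendsto' (((continuous_geomMean hz.1).tendsto z).comp hlim)
      fun n => hanti (Nat.zero_le (φ n)))

/-- The derivative of the Volterra operator at `m` in the direction `v`. -/
def volterraDeriv (A : Matrix ι ι ℝ) (m : ι → ℝ) : (ι → ℝ) →ₗ[ℝ] ι → ℝ where
  toFun v := fun k => v k * (1 + A.mulVec m k) + m k * A.mulVec v k
  map_add' v w := by
    funext k
    simp only [Matrix.mulVec_add, Pi.add_apply]
    ring
  map_smul' c v := by
    funext k
    simp only [Matrix.mulVec_smul, Pi.smul_apply, smul_eq_mul, RingHom.id_apply]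
    ring

lemma volterraDeriv_apply (m v : ι → ℝ) (k : ι) :
    volterraDeriv A m v k = v k * (1 + A.mulVec m k) + m k * A.mulVec v k := rfl

lemma volterraMap_sub (x y : ι → ℝ) :
    volterraMap A x - volterraMap A y = volterraDeriv A (midpoint ℝ x y) (x - y) := by
  funext k
  rw [midpoint_eq_smul_add, volterraDeriv_apply]
  simp only [volterraMap, Pi.sub_apply, Matrix.mulVec_smul, Matrix.mulVec_add, Matrix.mulVec_sub,
    Pi.smul_apply, Pi.add_apply, smul_eq_mul, invOf_eq_inv]
  ring

lemma sum_volterraDeriv (hA : A.transpose = -A) (m v : ι → ℝ) :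
    ∑ k, volterraDeriv A m v k = ∑ k, v k := by
  have := dotProduct_mulVec_skew hA m v
  simp only [dotProduct] at this
  simp only [volterraDeriv_apply, mul_add, mul_one, sum_add_distrib, this]
  ring

lemma volterraDeriv_injective (hA : A.transpose = -A) (hlt : ∀ i j, |A i j| < 1) {m : ι → ℝ}
    (hm : m ∈ openSimplex ι) : Function.Injective (volterraDeriv A m) := by
  refine (injective_iff_map_eq_zero _).2 fun v hv => ?_
  have hpos := one_add_mulVec_pos hlt (openSimplex_subset hm)
  have h1 : ∑ k, v k ^ 2 * (1 + A.mulVec m k) / m k = 0 := by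
    have h2 : ∑ k, v k / m k * volterraDeriv A m v k = 0 := by simp [hv]
    have h3 : ∑ k, v k / m k * volterraDeriv A m v k =
        ∑ k, v k ^ 2 * (1 + A.mulVec m k) / m k + v ⬝ᵥ A.mulVec v := by
      rw [dotProduct, ← sum_add_distrib]
      refine sum_congr rfl fun k _ => ?_
      have := (hm.1 k).ne'
      rw [volterraDeriv_apply]
      field_simp
    rw [h3, dotProduct_mulVec_self hA, add_zero] at h2
    exact h2
  have h0 : ∀ k ∈ (univ : Finset ι), 0 ≤ v k ^ 2 * (1 + A.mulVec m k) / m k := fun k _ =>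
    div_nonneg (mul_nonneg (sq_nonneg _) (hpos k).le) (hm.1 k).le
  funext k
  have h2 := (sum_eq_zero_iff_of_nonneg h0).1 h1 k (Finset.mem_univ k)
  simpa [(hm.1 k).ne', (hpos k).ne'] using h2

lemma hasDerivAt_volterraMap {γ : ℝ → ι → ℝ} {u : ι → ℝ} {t : ℝ} (h : HasDerivAt γ u t) :
    HasDerivAt (fun s => volterraMap A (γ s)) (volterraDeriv A (γ t) u) t := by
  rw [hasDerivAt_pi] at h ⊢
  intro k
  refine (h k).mul (HasDerivAt.const_add 1 ?_)
  exact HasDerivAt.fun_sum fun i _ => (h i).const_mul (A k i)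

/-- Every direction tangent to the simplex is the velocity of the image under an iterate of the
Volterra operator of a uniform motion inside the simplex. -/
lemma exists_hasDerivAt_iterate (hA : A.transpose = -A) (hlt : ∀ i j, |A i j| < 1) {x : ι → ℝ}
    (hx : x ∈ openSimplex ι) (N : ℕ) (u : ι → ℝ) (hu : ∑ i, u i = 0) :
    ∃ w : ι → ℝ, ∑ i, w i = 0 ∧
      HasDerivAt (fun t : ℝ => (volterraMap A)^[N] (x + t • w)) u 0 := by
  induction N generalizing u with
  | zero =>
    refine ⟨u, hu, ?_⟩
    simpa using ((hasDerivAt_id (0 : ℝ)).smul_const u).const_add x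
  | succ N ih =>
    obtain ⟨u', rfl⟩ := LinearMap.injective_iff_surjective.1
      (volterraDeriv_injective hA hlt (iterate_volterraMap_mem hA hlt hx N)) u
    rw [sum_volterraDeriv hA] at hu
    obtain ⟨w, hw, hd⟩ := ih u' hu
    refine ⟨w, hw, ?_⟩
    simp only [Function.iterate_succ_apply']
    simpa using hasDerivAt_volterraMap (A := A) hd

/-- A quadratic form measuring how far a direction is from the contracting axis `j`. -/
noncomputable def coneForm (z : ι → ℝ) (j : ι) (K : ℝ) (v : ι → ℝ) : ℝ :=
  ∑ i, v i ^ 2 / z i - K * v j ^ 2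

lemma continuous_coneForm (z : ι → ℝ) (j : ι) (K : ℝ) : Continuous (coneForm z j K) := by
  unfold coneForm
  fun_prop

lemma coneForm_smul (z : ι → ℝ) (j : ι) (K t : ℝ) (v : ι → ℝ) :
    coneForm z j K (t • v) = t ^ 2 * coneForm z j K v := by
  simp only [coneForm, Pi.smul_apply, smul_eq_mul, mul_sub, mul_sum]
  congr 1
  · exact sum_congr rfl fun i _ => by ring
  · ring

lemma coneForm_volterraDeriv (hA : A.transpose = -A) {z : ι → ℝ} {j : ι} (hzj : z j = 0)
    (hzpos : ∀ i, i ≠ j → 0 < z i) (hAz : ∀ i, i ≠ j → A.mulVec z i = 0) (K : ℝ) (v : ι → ℝ) :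
    coneForm z j K (volterraDeriv A z v) = coneForm z j K v +
      (∑ i, z i * A.mulVec v i ^ 2 - 2 * (v j * A.mulVec v j) +
        K * ((1 - (1 + A.mulVec z j) ^ 2) * v j ^ 2)) := by
  classical
  have hj : volterraDeriv A z v j = v j * (1 + A.mulVec z j) := by
    rw [volterraDeriv_apply, hzj]; ring
  have h1 : ∑ i, volterraDeriv A z v i ^ 2 / z i = ∑ i, (v i ^ 2 / z i + 2 * (v i * A.mulVec v i)
      + z i * A.mulVec v i ^ 2 - if i = j then 2 * (v i * A.mulVec v i) else 0) := by
    refine sum_congr rfl fun i _ => ?_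
    by_cases hi : i = j
    · subst hi
      simp [hzj]
    · have := (hzpos i hi).ne'
      rw [volterraDeriv_apply, hAz i hi, if_neg hi]
      field_simp
      ring
  have h2 := dotProduct_mulVec_self hA v
  rw [dotProduct] at h2
  simp only [coneForm, hj, h1, sum_sub_distrib, sum_add_distrib, ← mul_sum, h2, sum_ite_eq',
    Finset.mem_univ, if_true]
  ring

lemma continuous_volterraDeriv :
    Continuous fun p : (ι → ℝ) × (ι → ℝ) => volterraDeriv A p.1 p.2 := by
  refine continuous_pi fun k => ?_
  simp only [volterraDeriv_apply]
  have h1 := (continuous_mulVec_apply (A := A) k).comp (continuous_fst (X := ι → ℝ) (Y := ι → ℝ))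
  have h2 := (continuous_mulVec_apply (A := A) k).comp (continuous_snd (X := ι → ℝ) (Y := ι → ℝ))
  simp only [Function.comp_def] at h1 h2
  fun_prop

/-- Near a fixed point which is repelling inside a facet and attracting across it, some quadratic
form which is positive on the facet does not decrease under the linearized dynamics. -/
lemma exists_coneForm_le (hA : A.transpose = -A) (hlt : ∀ i j, |A i j| < 1) {z : ι → ℝ}
    (hz : z ∈ stdSimplex ℝ ι) {j : ι} (hzj : z j = 0)
    (hzpos : ∀ i, i ≠ j → 0 < z i) (hAz : ∀ i, i ≠ j → A.mulVec z i = 0) (hneg : A.mulVec z j < 0)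
    (hker : ∀ v : ι → ℝ, ∑ i, v i = 0 → v j = 0 → (∀ i, i ≠ j → A.mulVec v i = 0) → v = 0) :
    ∃ K : ℝ, ∃ U ∈ 𝓝 z, ∀ m ∈ U, ∀ v : ι → ℝ, ∑ i, v i = 0 →
      coneForm z j K v ≤ coneForm z j K (volterraDeriv A m v) := by
  set C : Set (ι → ℝ) := Metric.sphere 0 1 ∩ {v | ∑ i, v i = 0} with hC
  have hCc : IsCompact C := (isCompact_sphere 0 1).inter_right
    (isClosed_eq (continuous_finsetSum _ fun i _ => continuous_apply i) continuous_const)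
  set κ := 1 - (1 + A.mulVec z j) ^ 2 with hκ
  have hκ0 : 0 < κ := by nlinarith [one_add_mulVec_pos hlt hz j]
  set P : (ι → ℝ) → ℝ := fun v => ∑ i, z i * A.mulVec v i ^ 2 - 2 * (v j * A.mulVec v j) with hP
  have hcm := fun k => continuous_mulVec_apply (A := A) k
  have hPc : Continuous P := by fun_prop
  obtain ⟨K, hK⟩ : ∃ K : ℕ, C ⊆ {v | 0 < P v + K * (κ * v j ^ 2)} := by
    refine hCc.elim_directed_cover _ (fun K => ?_) (fun v hv => ?_) ?_
    · exact isOpen_lt continuous_const (by fun_prop)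
    · simp only [mem_iUnion, mem_ofPred_eq]
      by_cases hvj : v j = 0
      · refine ⟨0, ?_⟩
        simp only [hP, hvj, CharP.cast_eq_zero, zero_mul, mul_zero, sub_zero, add_zero]
        have h0 : ∀ i ∈ (univ : Finset ι), 0 ≤ z i * A.mulVec v i ^ 2 := fun i _ =>
          mul_nonneg (hz.1 i) (sq_nonneg _)
        refine lt_of_le_of_ne (sum_nonneg h0) fun h => ?_
        have h2 := (sum_eq_zero_iff_of_nonneg h0).1 h.symm
        have hv0 := hker v hv.2 hvj fun i hi => by
          simpa [(hzpos i hi).ne'] using h2 i (Finset.mem_univ i)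
        have := hv.1
        simp [hv0] at this
      · have hp : 0 < κ * v j ^ 2 := by positivity
        obtain ⟨n, hn⟩ := exists_nat_gt (-P v / (κ * v j ^ 2))
        rw [div_lt_iff₀ hp] at hn
        exact ⟨n, by linarith⟩
    · refine Monotone.directed_le fun a b hab v hv => ?_
      have hab' : (a : ℝ) ≤ b := by exact_mod_cast hab
      have : (a : ℝ) * (κ * v j ^ 2) ≤ b * (κ * v j ^ 2) := by gcongr
      simp only [mem_ofPred_eq] at hv ⊢
      linarith
  have hcone := continuous_coneForm z j (K : ℝ)
  obtain ⟨U, W, hU, -, hzU, hCW, hUW⟩ := generalized_tube_lemma (isCompact_singleton (x := z)) hCc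
    (n := {p : (ι → ℝ) × (ι → ℝ) | coneForm z j K p.2 < coneForm z j K (volterraDeriv A p.1 p.2)})
    (isOpen_lt (hcone.comp continuous_snd) (hcone.comp continuous_volterraDeriv)) (by
      rintro ⟨m, v⟩ ⟨rfl, hv⟩
      have := hK hv
      simp only [mem_ofPred_eq] at this ⊢
      rw [coneForm_volterraDeriv hA hzj hzpos hAz]
      simp only [hP, hκ] at this
      linarith)
  refine ⟨K, U, hU.mem_nhds (hzU rfl), fun m hm v hv => ?_⟩
  rcases eq_or_ne v 0 with rfl | hv0
  · simp
  · have hn : ‖v‖ ≠ 0 := norm_ne_zero_iff.2 hv0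
    have hw : ‖v‖⁻¹ • v ∈ C := by
      refine ⟨by simp [norm_smul, hn], ?_⟩
      simp [← mul_sum, hv]
    have h := hUW (mk_mem_prod hm (hCW hw))
    simp only [mem_ofPred_eq] at h
    rw [map_smul, coneForm_smul, coneForm_smul] at h
    exact (lt_of_mul_lt_mul_left h (sq_nonneg _)).le

/-- The stable set of a fixed point which is repelling inside a facet does not contain the whole
interior of the simplex. -/
lemma exists_not_tendsto_saddle (hA : A.transpose = -A) (hlt : ∀ i j, |A i j| < 1) {z : ι → ℝ}
    (hz : z ∈ stdSimplex ℝ ι) {j : ι} (hzj : z j = 0)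
    (hzpos : ∀ i, i ≠ j → 0 < z i) (hAz : ∀ i, i ≠ j → A.mulVec z i = 0) (hneg : A.mulVec z j < 0)
    (hker : ∀ v : ι → ℝ, ∑ i, v i = 0 → v j = 0 → (∀ i, i ≠ j → A.mulVec v i = 0) → v = 0)
    {u : ι → ℝ} (hu : ∑ i, u i = 0) (huj : u j = 0) (hu0 : u ≠ 0) :
    ∃ x ∈ openSimplex ι, ¬ Tendsto (fun n => (volterraMap A)^[n] x) atTop (𝓝 z) := by
  by_contra! hall
  obtain ⟨K, U, hU, hform⟩ := exists_coneForm_le hA hlt hz hzj hzpos hAz hneg hker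
  obtain ⟨r, hr, hrU⟩ := Metric.nhds_basis_closedBall.mem_iff.1 hU
  have hcard : (0 : ℝ) < Fintype.card ι := by exact_mod_cast Fintype.card_pos_iff.2 ⟨j⟩
  set b : ℝ := (Fintype.card ι : ℝ)⁻¹ with hb
  have hb0 : 0 < b := inv_pos.2 hcard
  have hbsum : ∑ _i : ι, b = 1 := by simp [hb, hcard.ne']
  set S : Set (ι → ℝ) := {x | (∀ i, b / 2 ≤ x i) ∧ ∑ i, x i = 1} with hS
  have hSsub : S ⊆ openSimplex ι := fun x hx => ⟨fun i => (half_pos hb0).trans_le (hx.1 i), hx.2⟩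
  have hScl : IsClosed S := by
    rw [hS, ofPred_and, ofPred_forall]
    exact (isClosed_iInter fun i => isClosed_le continuous_const (continuous_apply i)).inter
      (isClosed_eq (continuous_finsetSum _ fun i _ => continuous_apply i) continuous_const)
  have : CompleteSpace S := hScl.completeSpace_coe
  have : Nonempty S := ⟨⟨fun _ => b, fun _ => by linarith, hbsum⟩⟩
  obtain ⟨N, x₀, hx₀⟩ := nonempty_interior_of_iUnion_of_closed (X := S)
    (f := fun N : ℕ => {x : S | ∀ n, N ≤ n → (volterraMap A)^[n] x ∈ Metric.closedBall z r})
    (fun N => by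
      simp only [ofPred_forall]
      exact isClosed_iInter fun n => isClosed_iInter fun _ => Metric.isClosed_closedBall.preimage
        ((continuous_volterraMap.iterate n).comp continuous_subtype_val))
    (by
      refine eq_univ_of_forall fun x => mem_iUnion.2 ?_
      exact eventually_atTop.1 ((hall x (hSsub x.2)).eventually (Metric.closedBall_mem_nhds z hr)))
  obtain ⟨ε, hε, hball⟩ := Metric.mem_nhds_iff.1 (mem_interior_iff_mem_nhds.1 hx₀)
  have hstay : ∀ y ∈ S, dist y x₀ < ε → ∀ n, N ≤ n →
      (volterraMap A)^[n] y ∈ Metric.closedBall z r := fun y hy hd => @hball ⟨y, hy⟩ hd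
  obtain ⟨y, hyS, hyb, hyd⟩ : ∃ y : ι → ℝ, ∑ i, y i = 1 ∧ (∀ i, b / 2 < y i) ∧ dist y x₀ < ε := by
    have hc : Tendsto (fun t : ℝ => (x₀ : ι → ℝ) + t • ((fun _ => b) - (x₀ : ι → ℝ))) (𝓝[>] 0)
        (𝓝 ((x₀ : ι → ℝ) + (0 : ℝ) • ((fun _ => b) - (x₀ : ι → ℝ)))) :=
      (Continuous.tendsto (by fun_prop) 0).mono_left nhdsWithin_le_nhds
    rw [zero_smul, add_zero] at hc
    obtain ⟨t, hd, ht, ht1⟩ := ((hc.eventually (Metric.ball_mem_nhds _ hε)).and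
      (Ioo_mem_nhdsGT one_pos)).exists
    refine ⟨_, ?_, fun i => ?_, hd⟩
    · simp [sum_add_distrib, ← mul_sum, x₀.2.2, hcard.ne', hb]
    · have := x₀.2.1 i
      simp only [Pi.add_apply, Pi.smul_apply, Pi.sub_apply, smul_eq_mul]
      nlinarith
  have hyS' : y ∈ S := ⟨fun i => (hyb i).le, hyS⟩
  obtain ⟨w, hw, hder⟩ := exists_hasDerivAt_iterate hA hlt (hSsub hyS') N u hu
  have hRu : 0 < coneForm z j K u := by
    have h0 : ∀ i ∈ (univ : Finset ι), 0 ≤ u i ^ 2 / z i := fun i _ =>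
      div_nonneg (sq_nonneg _) (hz.1 i)
    rw [coneForm, huj, zero_pow two_ne_zero, mul_zero, sub_zero]
    refine lt_of_le_of_ne (sum_nonneg h0) fun h => hu0 (funext fun i => ?_)
    have h2 := (sum_eq_zero_iff_of_nonneg h0).1 h.symm i (Finset.mem_univ i)
    by_cases hi : i = j
    · rw [hi, huj, Pi.zero_apply]
    · simpa [(hzpos i hi).ne'] using h2
  have hslope := hasDerivAt_iff_tendsto_slope_zero.1 hder
  have hev1 := (((continuous_coneForm z j K).tendsto u).comp hslope).eventually (lt_mem_nhds hRu)
  have hline : Tendsto (fun t : ℝ => y + t • w) (𝓝[≠] 0) (𝓝 (y + (0 : ℝ) • w)) :=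
    (Continuous.tendsto (by fun_prop) 0).mono_left nhdsWithin_le_nhds
  rw [zero_smul, add_zero] at hline
  have hev2 : ∀ᶠ t : ℝ in 𝓝[≠] 0, dist (y + t • w) x₀ < ε :=
    hline.eventually (Metric.isOpen_ball.mem_nhds hyd)
  have hev3 : ∀ᶠ t : ℝ in 𝓝[≠] 0, ∀ i, b / 2 < (y + t • w) i :=
    eventually_all.2 fun i =>
      (((continuous_apply i).tendsto y).comp hline).eventually (lt_mem_nhds (hyb i))
  obtain ⟨t, ⟨⟨ht1, ht2⟩, ht3⟩, ht0⟩ :=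
    (((hev1.and hev2).and hev3).and self_mem_nhdsWithin).exists
  set y' := y + t • w with hy'
  have hy'S : y' ∈ S := ⟨fun i => (ht3 i).le, by simp [hy', sum_add_distrib, ← mul_sum, hw, hyS]⟩
  set d : ℕ → ι → ℝ := fun n => (volterraMap A)^[n] y' - (volterraMap A)^[n] y with hd
  have hdN : 0 < coneForm z j K (d N) := by
    simp only [Function.comp_apply, zero_add, zero_smul, add_zero] at ht1
    rw [coneForm_smul] at ht1
    have ht0' : t ≠ 0 := ht0
    exact (pos_iff_pos_of_mul_pos ht1).1 (by positivity)
  have hmono : ∀ n, coneForm z j K (d N) ≤ coneForm z j K (d (N + n)) := by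
    intro n
    induction n with
    | zero => rfl
    | succ n ih =>
      refine ih.trans ?_
      have h1 : d (N + (n + 1)) = volterraDeriv A (midpoint ℝ ((volterraMap A)^[N + n] y')
          ((volterraMap A)^[N + n] y)) (d (N + n)) := by
        simp only [hd, ← add_assoc, Function.iterate_succ_apply', volterraMap_sub]
      rw [h1]
      refine hform _ (hrU ?_) _ ?_
      · exact (convex_closedBall z r).midpoint_mem (hstay y' hy'S ht2 _ (Nat.le_add_right _ _))
          (hstay y hyS' hyd _ (Nat.le_add_right _ _))
      · simp [hd, (iterate_volterraMap_mem hA hlt (hSsub hy'S) _).2,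
          (iterate_volterraMap_mem hA hlt (hSsub hyS') _).2]
  have hlim : Tendsto d atTop (𝓝 (z - z)) := (hall y' (hSsub hy'S)).sub (hall y (hSsub hyS'))
  have hlim2 := ((continuous_coneForm z j K).tendsto _).comp hlim
  have h0 : coneForm z j K (z - z) = 0 := by simp [coneForm]
  rw [h0] at hlim2
  have := ge_of_tendsto hlim2 (eventually_atTop.2 ⟨N, fun n hn => by
    obtain ⟨k, rfl⟩ := Nat.exists_eq_add_of_le hn
    exact hmono k⟩)
  linarith

/-- Some interior point has an orbit whose time averages do not concentrate at the saddle `z`. -/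
lemma exists_not_mean_saddle (hA : A.transpose = -A) (hlt : ∀ i j, |A i j| < 1) {z : ι → ℝ}
    (hz : z ∈ stdSimplex ℝ ι) {j : ι} (hzj : z j = 0)
    (hzpos : ∀ i, i ≠ j → 0 < z i) (hAz : ∀ i, i ≠ j → A.mulVec z i = 0) (hneg : A.mulVec z j < 0)
    (hker : ∀ v : ι → ℝ, ∑ i, v i = 0 → v j = 0 → (∀ i, i ≠ j → A.mulVec v i = 0) → v = 0)
    {u : ι → ℝ} (hu : ∑ i, u i = 0) (huj : u j = 0) (hu0 : u ≠ 0) :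
    ∃ x ∈ openSimplex ι, ErgodicAt A x →
      ¬ HasCesaroMean (fun n => faceDefect A z ((volterraMap A)^[n] x)) 0 := by
  obtain ⟨x, hx, hnot⟩ := exists_not_tendsto_saddle hA hlt hz hzj hzpos hAz hneg hker hu huj hu0
  refine ⟨x, hx, fun herg hmean => hnot ?_⟩
  have huniq : ∀ y ∈ stdSimplex ℝ ι, faceDefect A z y = 0 → y = z := by
    intro y hy h
    have h1 := faceDefect_eq_zero hy h
    refine sub_eq_zero.1 (hker _ (by simp [hy.2, hz.2]) ?_ fun i hi => ?_)
    · simp [(h1 j).2 (by simp [hzj]), hzj]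
    · rw [Matrix.mulVec_sub, Pi.sub_apply, (h1 i).1 (hzpos i hi), hAz i hi, sub_zero]
  obtain ⟨y, hy, hy0, φ, hφ, hlim⟩ := exists_subseq_tendsto hA hlt hx hmean
  rw [huniq y hy hy0] at hlim
  exact tendsto_of_subseq hA hlt hx hz hAz (summable_of_mean_log_neg hA hlt hx
    (mean_log_of_unique hA hlt hx herg hmean huniq j)
    (Real.log_neg (one_add_mulVec_pos hlt hz j) (by linarith))) hφ hlim

/-- A vertex at which some other coordinate grows does not carry the time averages. -/
lemma exists_ne_pos_of_mean (hA : A.transpose = -A) (hlt : ∀ i j, |A i j| < 1)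
    (hout : ∀ i, ∃ k, 0 < A k i) {x m : ι → ℝ} (hx : x ∈ openSimplex ι) (herg : ErgodicAt A x)
    (hmem : m ∈ stdSimplex ℝ ι)
    (hm : HasCesaroMean (fun n => faceDefect A m ((volterraMap A)^[n] x)) 0) (i : ι) :
    ∃ j, j ≠ i ∧ 0 < m j := by
  classical
  by_contra! h
  have heq : ∀ y ∈ stdSimplex ℝ ι, (∀ j, j ≠ i → y j = 0) → y = Pi.single i 1 := by
    intro y hy h0
    have h1 : y i = 1 := by
      rw [← hy.2]; exact (sum_eq_single i (fun j _ hj => h0 j hj) (by simp)).symm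
    funext j
    by_cases hj : j = i
    · subst hj; simp [h1]
    · simp [h0 j hj, hj]
  have hmi := heq m hmem fun j hj => le_antisymm (h j hj) (hmem.1 j)
  obtain ⟨k, hk⟩ := hout i
  have h1 := mulVec_nonpos_of_unique hA hlt hx herg hm (fun y hy h0 => by
    rw [heq y hy fun j hj => (faceDefect_eq_zero hy h0 j).2 (not_lt.2 (h j hj)), hmi]) k
  rw [hmi, Matrix.mulVec_single_one] at h1
  exact absurd hk (not_lt.2 h1)

end Volterra

/-- The canonical skew-symmetric matrix of the third class. -/
def thirdClassMatrix (a b c d e f : ℝ) : Matrix (Fin 4) (Fin 4) ℝ :=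
  !![0, a, b, -c; -a, 0, d, e; -b, -d, 0, f; c, -e, -f, 0]

section ThirdClass

variable {a b c d e f : ℝ}

lemma thirdClassMatrix_mulVec (y : Fin 4 → ℝ) :
    (thirdClassMatrix a b c d e f).mulVec y = ![a * y 1 + b * y 2 + -c * y 3,
      -a * y 0 + d * y 2 + e * y 3, -b * y 0 + -d * y 1 + f * y 3,
      c * y 0 + -e * y 1 + -f * y 2] := by
  funext k
  fin_cases k <;>
    simp [thirdClassMatrix, Matrix.mulVec, dotProduct, Fin.sum_univ_four]

lemma volterraMap_thirdClassMatrix :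
    volterraMap (thirdClassMatrix a b c d e f) = volterra3 a b c d e f := by
  funext x k
  rw [volterraMap, thirdClassMatrix_mulVec]
  fin_cases k <;> simp [volterra3]

lemma thirdClassMatrix_transpose :
    (thirdClassMatrix a b c d e f).transpose = -thirdClassMatrix a b c d e f := by
  ext i j
  fin_cases i <;> fin_cases j <;> simp [thirdClassMatrix]

lemma mem_stdSimplex_four {y : Fin 4 → ℝ} (hy : y ∈ stdSimplex ℝ (Fin 4)) :
    0 ≤ y 0 ∧ 0 ≤ y 1 ∧ 0 ≤ y 2 ∧ 0 ≤ y 3 ∧ y 0 + y 1 + y 2 + y 3 = 1 :=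
  ⟨hy.1 0, hy.1 1, hy.1 2, hy.1 3, by rw [← hy.2, Fin.sum_univ_four]⟩

lemma thirdClassMatrix_mulVec_apply (y : Fin 4 → ℝ) :
    (thirdClassMatrix a b c d e f).mulVec y 0 = a * y 1 + b * y 2 - c * y 3 ∧
    (thirdClassMatrix a b c d e f).mulVec y 1 = -a * y 0 + d * y 2 + e * y 3 ∧
    (thirdClassMatrix a b c d e f).mulVec y 2 = -b * y 0 - d * y 1 + f * y 3 ∧
    (thirdClassMatrix a b c d e f).mulVec y 3 = c * y 0 - e * y 1 - f * y 2 := by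
  rw [thirdClassMatrix_mulVec]
  refine ⟨?_, ?_, ?_, ?_⟩ <;> simp [sub_eq_add_neg]

/-- The possible supports of an average with at least two nonzero coordinates. -/
lemma support_cases (ha : 0 < a) (hb : 0 < b) (hc : 0 < c) (hd : 0 < d) (he : 0 < e) (hf : 0 < f)
    {m : Fin 4 → ℝ} (hm : m ∈ stdSimplex ℝ (Fin 4))
    (hcrit : ∀ i, 0 < m i → (thirdClassMatrix a b c d e f).mulVec m i = 0)
    (hne : ∀ i, ∃ j, j ≠ i ∧ 0 < m j) :
    0 < m 0 ∧ 0 < m 3 ∧ (0 < m 1 ∧ m 2 = 0 ∨ m 1 = 0 ∧ 0 < m 2 ∨ 0 < m 1 ∧ 0 < m 2) := by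
  obtain ⟨h0, h1, h2, h3, -⟩ := mem_stdSimplex_four hm
  obtain ⟨e0, e1, e2, e3⟩ := thirdClassMatrix_mulVec_apply (a := a) (b := b) (c := c) (d := d)
    (e := e) (f := f) m
  have k0 := fun h => e0.symm.trans (hcrit 0 h)
  have k1 := fun h => e1.symm.trans (hcrit 1 h)
  have k2 := fun h => e2.symm.trans (hcrit 2 h)
  have k3 := fun h => e3.symm.trans (hcrit 3 h)
  have n0 := hne 0
  have n1 := hne 1
  have n2 := hne 2
  have n3 := hne 3
  simp only [Fin.exists_fin_succ, Fin.exists_fin_zero] at n0 n1 n2 n3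
  simp [Fin.reduceSucc] at n0 n1 n2 n3
  have g0 : 0 < m 0 := by
    by_contra hn
    have z0 : m 0 = 0 := by linarith
    rcases h3.eq_or_lt with g3 | g3
    · have g1 : 0 < m 1 := by grind
      have g2 : 0 < m 2 := by grind
      have := k1 g1
      have := mul_pos hd g2
      rw [z0, ← g3] at *
      linarith
    · have := k3 g3
      have := mul_nonneg he.le h1
      have := mul_nonneg hf.le h2
      have g1 : e * m 1 = 0 := by rw [z0] at *; linarith
      have g2 : f * m 2 = 0 := by rw [z0] at *; linarith
      have g1' : m 1 = 0 := by simpa [he.ne'] using g1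
      have g2' : m 2 = 0 := by simpa [hf.ne'] using g2
      grind
  have g3 : 0 < m 3 := by
    by_contra hn
    have z3 : m 3 = 0 := by linarith
    have := k0 g0
    have := mul_nonneg ha.le h1
    have := mul_nonneg hb.le h2
    have g1 : a * m 1 = 0 := by rw [z3] at *; linarith
    have g2 : b * m 2 = 0 := by rw [z3] at *; linarith
    have g1' : m 1 = 0 := by simpa [ha.ne'] using g1
    have g2' : m 2 = 0 := by simpa [hb.ne'] using g2
    grind
  refine ⟨g0, g3, ?_⟩
  rcases h1.eq_or_lt with g1 | g1 <;> rcases h2.eq_or_lt with g2 | g2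
  · have := k3 g3
    have := mul_pos hc g0
    rw [← g1, ← g2] at *
    linarith
  · exact Or.inr (Or.inl ⟨g1.symm, g2⟩)
  · exact Or.inl ⟨g1, g2.symm⟩
  · exact Or.inr (Or.inr ⟨g1, g2⟩)

lemma abs_thirdClassMatrix_lt_one (ha : a ∈ Ioo (0 : ℝ) 1) (hb : b ∈ Ioo (0 : ℝ) 1)
    (hc : c ∈ Ioo (0 : ℝ) 1) (hd : d ∈ Ioo (0 : ℝ) 1) (he : e ∈ Ioo (0 : ℝ) 1)
    (hf : f ∈ Ioo (0 : ℝ) 1) (i j : Fin 4) : |thirdClassMatrix a b c d e f i j| < 1 := by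
  obtain ⟨ha, ha'⟩ := ha
  obtain ⟨hb, hb'⟩ := hb
  obtain ⟨hc, hc'⟩ := hc
  obtain ⟨hd, hd'⟩ := hd
  obtain ⟨he, he'⟩ := he
  obtain ⟨hf, hf'⟩ := hf
  fin_cases i <;> fin_cases j <;> simp [thirdClassMatrix, abs_of_pos, *]

lemma exists_thirdClassMatrix_pos (ha : 0 < a) (hb : 0 < b) (hc : 0 < c) (he : 0 < e) (i : Fin 4) :
    ∃ k, 0 < thirdClassMatrix a b c d e f k i := by
  fin_cases i
  · exact ⟨3, by simpa [thirdClassMatrix]⟩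
  · exact ⟨0, by simpa [thirdClassMatrix]⟩
  · exact ⟨0, by simpa [thirdClassMatrix]⟩
  · exact ⟨1, by simpa [thirdClassMatrix]⟩

/-- The face spanned by the vertices `0, 1, 3` carries a single interior fixed point. -/
lemma eq_of_face_zero_one_three (ha : 0 < a) (hc : 0 < c) (he : 0 < e) {v : Fin 4 → ℝ}
    (hs : ∑ i, v i = 0) (h2 : v 2 = 0) (h0 : (thirdClassMatrix a b c d e f).mulVec v 0 = 0)
    (h1 : (thirdClassMatrix a b c d e f).mulVec v 1 = 0) : v = 0 := by
  obtain ⟨e0, e1, -, -⟩ := thirdClassMatrix_mulVec_apply (a := a) (b := b) (c := c) (d := d)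
    (e := e) (f := f) v
  rw [Fin.sum_univ_four] at hs
  rw [h0, h2] at e0
  rw [h1, h2] at e1
  have h3 : v 3 = 0 := by
    have : (e + c + a) * v 3 = 0 := by linear_combination a * hs + e0 - e1 - a * h2
    exact (mul_eq_zero.1 this).resolve_left (by positivity)
  have h1' : v 1 = 0 := by
    have : a * v 1 = 0 := by linear_combination -e0 + c * h3
    exact (mul_eq_zero.1 this).resolve_left ha.ne'
  have h0' : v 0 = 0 := by linarith
  funext i
  fin_cases i <;> assumption

/-- The face spanned by the vertices `0, 2, 3` carries a single interior fixed point. -/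
lemma eq_of_face_zero_two_three (hb : 0 < b) (hc : 0 < c) (hf : 0 < f) {v : Fin 4 → ℝ}
    (hs : ∑ i, v i = 0) (h1 : v 1 = 0) (h0 : (thirdClassMatrix a b c d e f).mulVec v 0 = 0)
    (h2 : (thirdClassMatrix a b c d e f).mulVec v 2 = 0) : v = 0 := by
  obtain ⟨e0, -, e2, -⟩ := thirdClassMatrix_mulVec_apply (a := a) (b := b) (c := c) (d := d)
    (e := e) (f := f) v
  rw [Fin.sum_univ_four] at hs
  rw [h0, h1] at e0
  rw [h2, h1] at e2
  have h3 : v 3 = 0 := by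
    have : (f + c + b) * v 3 = 0 := by linear_combination b * hs + e0 - e2 - b * h1
    exact (mul_eq_zero.1 this).resolve_left (by positivity)
  have h2' : v 2 = 0 := by
    have : b * v 2 = 0 := by linear_combination -e0 + c * h3
    exact (mul_eq_zero.1 this).resolve_left hb.ne'
  have h0' : v 0 = 0 := by linarith
  funext i
  fin_cases i <;> assumption

lemma faceDefect_unique_zero_one_three (ha : 0 < a) (hc : 0 < c) (he : 0 < e) {m : Fin 4 → ℝ}
    (hm : m ∈ stdSimplex ℝ (Fin 4))
    (hcrit : ∀ i, 0 < m i → (thirdClassMatrix a b c d e f).mulVec m i = 0)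
    (m0 : 0 < m 0) (m1 : 0 < m 1) (m2 : m 2 = 0) :
    ∀ y ∈ stdSimplex ℝ (Fin 4), faceDefect (thirdClassMatrix a b c d e f) m y = 0 → y = m := by
  intro y hy h
  have h' := faceDefect_eq_zero hy h
  refine sub_eq_zero.1 (eq_of_face_zero_one_three (a := a) (b := b) (c := c) (d := d)
    (e := e) (f := f) ha hc he (by simp [hy.2, hm.2]) ?_ ?_ ?_)
  · simp [(h' 2).2 (by simp [m2]), m2]
  · rw [Matrix.mulVec_sub, Pi.sub_apply, (h' 0).1 m0, hcrit 0 m0, sub_zero]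
  · rw [Matrix.mulVec_sub, Pi.sub_apply, (h' 1).1 m1, hcrit 1 m1, sub_zero]

lemma faceDefect_unique_zero_two_three (hb : 0 < b) (hc : 0 < c) (hf : 0 < f) {m : Fin 4 → ℝ}
    (hm : m ∈ stdSimplex ℝ (Fin 4))
    (hcrit : ∀ i, 0 < m i → (thirdClassMatrix a b c d e f).mulVec m i = 0)
    (m0 : 0 < m 0) (m1 : m 1 = 0) (m2 : 0 < m 2) :
    ∀ y ∈ stdSimplex ℝ (Fin 4), faceDefect (thirdClassMatrix a b c d e f) m y = 0 → y = m := by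
  intro y hy h
  have h' := faceDefect_eq_zero hy h
  refine sub_eq_zero.1 (eq_of_face_zero_two_three (a := a) (b := b) (c := c) (d := d)
    (e := e) (f := f) hb hc hf (by simp [hy.2, hm.2]) ?_ ?_ ?_)
  · simp [(h' 1).2 (by simp [m1]), m1]
  · rw [Matrix.mulVec_sub, Pi.sub_apply, (h' 0).1 m0, hcrit 0 m0, sub_zero]
  · rw [Matrix.mulVec_sub, Pi.sub_apply, (h' 2).1 m2, hcrit 2 m2, sub_zero]

/-- The support of the average of an orbit is restricted by the sign of the Pfaffian. -/
lemma exists_mean_thirdClass (ha : a ∈ Ioo (0 : ℝ) 1) (hb : b ∈ Ioo (0 : ℝ) 1)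
    (hc : c ∈ Ioo (0 : ℝ) 1) (hd : d ∈ Ioo (0 : ℝ) 1) (he : e ∈ Ioo (0 : ℝ) 1)
    (hf : f ∈ Ioo (0 : ℝ) 1) {x : Fin 4 → ℝ} (hx : x ∈ openSimplex (Fin 4))
    (herg : ErgodicAt (thirdClassMatrix a b c d e f) x) :
    ∃ m ∈ stdSimplex ℝ (Fin 4),
      (∀ i, 0 < m i → (thirdClassMatrix a b c d e f).mulVec m i = 0) ∧
      HasCesaroMean (fun n => faceDefect (thirdClassMatrix a b c d e f) m
        ((volterraMap (thirdClassMatrix a b c d e f))^[n] x)) 0 ∧ 0 < m 0 ∧ 0 < m 3 ∧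
      (0 < m 1 ∧ m 2 = 0 ∧ a * f - b * e - c * d ≤ 0 ∨
        m 1 = 0 ∧ 0 < m 2 ∧ 0 ≤ a * f - b * e - c * d ∨
        0 < m 1 ∧ 0 < m 2 ∧ a * f - b * e - c * d = 0) := by
  have hA := thirdClassMatrix_transpose (a := a) (b := b) (c := c) (d := d) (e := e) (f := f)
  have hlt := abs_thirdClassMatrix_lt_one ha hb hc hd he hf
  obtain ⟨m, hm, hcrit, hmean⟩ := exists_mean hA hlt hx herg
  obtain ⟨m0, m3, hcases⟩ := support_cases ha.1 hb.1 hc.1 hd.1 he.1 hf.1 hm hcrit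
    (exists_ne_pos_of_mean hA hlt (exists_thirdClassMatrix_pos ha.1 hb.1 hc.1 he.1) hx herg hm hmean)
  obtain ⟨e0, e1, e2, e3⟩ := thirdClassMatrix_mulVec_apply (a := a) (b := b) (c := c) (d := d)
    (e := e) (f := f) m
  have c0 := hcrit 0 m0
  have c3 := hcrit 3 m3
  refine ⟨m, hm, hcrit, hmean, m0, m3, ?_⟩
  rcases hcases with ⟨m1, m2⟩ | ⟨m1, m2⟩ | ⟨m1, m2⟩
  · refine Or.inl ⟨m1, m2, ?_⟩
    have h := mulVec_nonpos_of_unique hA hlt hx herg hmean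
      (faceDefect_unique_zero_one_three ha.1 hc.1 he.1 hm hcrit m0 m1 m2) 2
    have c1 := hcrit 1 m1
    have key : (a * f - b * e - c * d) * m 3 =
        a * (thirdClassMatrix a b c d e f).mulVec m 2 := by
      rw [e2]
      linear_combination (-d) * (c0.symm.trans e0) + b * (c1.symm.trans e1)
    have := mul_nonneg ha.1.le (neg_nonneg.2 h)
    exact nonpos_of_mul_nonpos_left (by linarith) m3
  · refine Or.inr (Or.inl ⟨m1, m2, ?_⟩)
    have h := mulVec_nonpos_of_unique hA hlt hx herg hmean
      (faceDefect_unique_zero_two_three hb.1 hc.1 hf.1 hm hcrit m0 m1 m2) 1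
    have c2 := hcrit 2 m2
    have key : (a * f - b * e - c * d) * m 3 =
        -(b * (thirdClassMatrix a b c d e f).mulVec m 1) := by
      rw [e1]
      linear_combination (-d) * (c0.symm.trans e0) - a * (c2.symm.trans e2)
    have := mul_nonneg hb.1.le (neg_nonneg.2 h)
    exact nonneg_of_mul_nonneg_left (by linarith) m3
  · refine Or.inr (Or.inr ⟨m1, m2, ?_⟩)
    have c2 := hcrit 2 m2
    have key : (a * f - b * e - c * d) * m 1 = 0 := by
      linear_combination (-f) * (c0.symm.trans e0) - c * (c2.symm.trans e2) - b * (c3.symm.trans e3)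
    exact (mul_eq_zero.1 key).resolve_right m1.ne'

lemma exists_not_ergodicAt_of_pfaffian_pos (ha : a ∈ Ioo (0 : ℝ) 1) (hb : b ∈ Ioo (0 : ℝ) 1)
    (hc : c ∈ Ioo (0 : ℝ) 1) (hd : d ∈ Ioo (0 : ℝ) 1) (he : e ∈ Ioo (0 : ℝ) 1)
    (hf : f ∈ Ioo (0 : ℝ) 1) (hpf : 0 < a * f - b * e - c * d) :
    ∃ x ∈ openSimplex (Fin 4), ¬ ErgodicAt (thirdClassMatrix a b c d e f) x := by
  have hA := thirdClassMatrix_transpose (a := a) (b := b) (c := c) (d := d) (e := e) (f := f)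
  have hlt := abs_thirdClassMatrix_lt_one ha hb hc hd he hf
  have hb0 := hb.1
  have hc0 := hc.1
  have hf0 := hf.1
  have hs : 0 < f + c + b := by positivity
  set z : Fin 4 → ℝ := ![f / (f + c + b), 0, c / (f + c + b), b / (f + c + b)] with hz
  have hzmem : z ∈ stdSimplex ℝ (Fin 4) := by
    refine ⟨fun i => ?_, ?_⟩
    · fin_cases i <;> simp [hz] <;> positivity
    · simp [hz, Fin.sum_univ_four]; field_simp
  obtain ⟨e0, e1, e2, e3⟩ := thirdClassMatrix_mulVec_apply (a := a) (b := b) (c := c) (d := d)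
    (e := e) (f := f) z
  have hzpos : ∀ i, i ≠ 1 → 0 < z i := by
    intro i hi
    fin_cases i <;> simp [hz] at hi ⊢ <;> positivity
  have hAz : ∀ i, i ≠ 1 → (thirdClassMatrix a b c d e f).mulVec z i = 0 := by
    intro i hi
    fin_cases i
    · refine e0.trans ?_
      simp [hz]; ring
    · simp at hi
    · refine e2.trans ?_
      simp [hz]; ring
    · refine e3.trans ?_
      simp [hz]; ring
  have hneg : (thirdClassMatrix a b c d e f).mulVec z 1 < 0 := by
    have : (thirdClassMatrix a b c d e f).mulVec z 1 =
        -((a * f - b * e - c * d) / (f + c + b)) := by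
      rw [e1]; simp [hz]; ring
    rw [this]
    exact neg_neg_of_pos (div_pos hpf hs)
  obtain ⟨x, hx, hnot⟩ := exists_not_mean_saddle hA hlt hzmem (j := 1) (by simp [hz]) hzpos hAz hneg
    (fun v hv h1 h => eq_of_face_zero_two_three hb0 hc0 hf0 hv h1 (h 0 (by decide))
      (h 2 (by decide)))
    (u := ![1, 0, -1, 0]) (by simp [Fin.sum_univ_four]) (by simp)
    (fun h => by simpa using congrFun h 0)
  refine ⟨x, hx, fun herg => hnot herg ?_⟩
  obtain ⟨m, hm, hcrit, hmean, m0, m3, h⟩ := exists_mean_thirdClass ha hb hc hd he hf hx herg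
  rcases h with ⟨-, -, h⟩ | ⟨m1, m2, -⟩ | ⟨-, -, h⟩
  · linarith
  · have hzm : z = m := by
      refine sub_eq_zero.1 (eq_of_face_zero_two_three (a := a) (b := b) (c := c) (d := d)
        (e := e) (f := f) hb0 hc0 hf0 (by simp [hzmem.2, hm.2]) (by simp [hz, m1]) ?_ ?_)
      · rw [Matrix.mulVec_sub, Pi.sub_apply, hAz 0 (by decide), hcrit 0 m0, sub_zero]
      · rw [Matrix.mulVec_sub, Pi.sub_apply, hAz 2 (by decide), hcrit 2 m2, sub_zero]
    rwa [hzm]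
  · linarith

lemma exists_not_ergodicAt_of_pfaffian_neg (ha : a ∈ Ioo (0 : ℝ) 1) (hb : b ∈ Ioo (0 : ℝ) 1)
    (hc : c ∈ Ioo (0 : ℝ) 1) (hd : d ∈ Ioo (0 : ℝ) 1) (he : e ∈ Ioo (0 : ℝ) 1)
    (hf : f ∈ Ioo (0 : ℝ) 1) (hpf : a * f - b * e - c * d < 0) :
    ∃ x ∈ openSimplex (Fin 4), ¬ ErgodicAt (thirdClassMatrix a b c d e f) x := by
  have hA := thirdClassMatrix_transpose (a := a) (b := b) (c := c) (d := d) (e := e) (f := f)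
  have hlt := abs_thirdClassMatrix_lt_one ha hb hc hd he hf
  have ha0 := ha.1
  have hc0 := hc.1
  have he0 := he.1
  have hs : 0 < e + c + a := by positivity
  set z : Fin 4 → ℝ := ![e / (e + c + a), c / (e + c + a), 0, a / (e + c + a)] with hz
  have hzmem : z ∈ stdSimplex ℝ (Fin 4) := by
    refine ⟨fun i => ?_, ?_⟩
    · fin_cases i <;> simp [hz] <;> positivity
    · simp [hz, Fin.sum_univ_four]; field_simp
  obtain ⟨e0, e1, e2, e3⟩ := thirdClassMatrix_mulVec_apply (a := a) (b := b) (c := c) (d := d)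
    (e := e) (f := f) z
  have hzpos : ∀ i, i ≠ 2 → 0 < z i := by
    intro i hi
    fin_cases i <;> simp [hz] at hi ⊢ <;> positivity
  have hAz : ∀ i, i ≠ 2 → (thirdClassMatrix a b c d e f).mulVec z i = 0 := by
    intro i hi
    fin_cases i
    · refine e0.trans ?_
      simp [hz]; ring
    · refine e1.trans ?_
      simp [hz]; ring
    · simp at hi
    · refine e3.trans ?_
      simp [hz]; ring
  have hneg : (thirdClassMatrix a b c d e f).mulVec z 2 < 0 := by
    have : (thirdClassMatrix a b c d e f).mulVec z 2 =
        (a * f - b * e - c * d) / (e + c + a) := by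
      rw [e2]; simp [hz]; ring
    rw [this]
    exact div_neg_of_neg_of_pos hpf hs
  obtain ⟨x, hx, hnot⟩ := exists_not_mean_saddle hA hlt hzmem (j := 2) (by simp [hz]) hzpos hAz hneg
    (fun v hv h2 h => eq_of_face_zero_one_three ha0 hc0 he0 hv h2 (h 0 (by decide))
      (h 1 (by decide)))
    (u := ![1, -1, 0, 0]) (by simp [Fin.sum_univ_four]) (by simp)
    (fun h => by simpa using congrFun h 0)
  refine ⟨x, hx, fun herg => hnot herg ?_⟩
  obtain ⟨m, hm, hcrit, hmean, m0, m3, h⟩ := exists_mean_thirdClass ha hb hc hd he hf hx herg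
  rcases h with ⟨m1, m2, -⟩ | ⟨-, -, h⟩ | ⟨-, -, h⟩
  · have hzm : z = m := by
      refine sub_eq_zero.1 (eq_of_face_zero_one_three (a := a) (b := b) (c := c) (d := d)
        (e := e) (f := f) ha0 hc0 he0 (by simp [hzmem.2, hm.2]) (by simp [hz, m2]) ?_ ?_)
      · rw [Matrix.mulVec_sub, Pi.sub_apply, hAz 0 (by decide), hcrit 0 m0, sub_zero]
      · rw [Matrix.mulVec_sub, Pi.sub_apply, hAz 1 (by decide), hcrit 1 m1, sub_zero]
    rwa [hzm]
  · linarith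
  · linarith

lemma exists_not_ergodicAt_of_pfaffian_zero (ha : a ∈ Ioo (0 : ℝ) 1) (hb : b ∈ Ioo (0 : ℝ) 1)
    (hc : c ∈ Ioo (0 : ℝ) 1) (hd : d ∈ Ioo (0 : ℝ) 1) (he : e ∈ Ioo (0 : ℝ) 1)
    (hf : f ∈ Ioo (0 : ℝ) 1) (hpf : a * f - b * e - c * d = 0) :
    ∃ x ∈ openSimplex (Fin 4), ¬ ErgodicAt (thirdClassMatrix a b c d e f) x := by
  have hA := thirdClassMatrix_transpose (a := a) (b := b) (c := c) (d := d) (e := e) (f := f)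
  have hlt := abs_thirdClassMatrix_lt_one ha hb hc hd he hf
  obtain ⟨x, hx, hx0⟩ : ∃ x ∈ openSimplex (Fin 4),
      (thirdClassMatrix a b c d e f).mulVec x ≠ 0 := by
    by_contra! h
    have h1 := h ![1 / 4, 1 / 4, 1 / 4, 1 / 4] ⟨fun i => by fin_cases i <;> simp, by
      simp [Fin.sum_univ_four]; norm_num⟩
    have h2 := h ![1 / 8, 1 / 4, 1 / 4, 3 / 8] ⟨fun i => by fin_cases i <;> simp, by
      simp [Fin.sum_univ_four]; norm_num⟩
    have h1' := congrFun h1 0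
    have h2' := congrFun h2 0
    rw [(thirdClassMatrix_mulVec_apply _).1] at h1' h2'
    simp at h1' h2'
    linarith [hc.1]
  refine ⟨x, hx, fun herg => hx0 ?_⟩
  obtain ⟨m, hm, hcrit, hmean, m0, m3, hcases⟩ := exists_mean_thirdClass ha hb hc hd he hf hx herg
  obtain ⟨y, hy, hdef, φ, -, hlim⟩ := exists_subseq_tendsto hA hlt hx hmean
  have h' := faceDefect_eq_zero hy hdef
  obtain ⟨e0, e1, e2, e3⟩ := thirdClassMatrix_mulVec_apply (a := a) (b := b) (c := c) (d := d)
    (e := e) (f := f) y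
  have c0 := (h' 0).1 m0
  have c3 := (h' 3).1 m3
  have hAy : (thirdClassMatrix a b c d e f).mulVec y = 0 := by
    have : (thirdClassMatrix a b c d e f).mulVec y 1 = 0 ∧
        (thirdClassMatrix a b c d e f).mulVec y 2 = 0 := by
      rcases hcases with ⟨m1, m2, -⟩ | ⟨m1, m2, -⟩ | ⟨m1, m2, -⟩
      · have c1 := (h' 1).1 m1
        refine ⟨c1, (mul_eq_zero.1 (?_ : a * _ = 0)).resolve_left ha.1.ne'⟩
        rw [e2]
        linear_combination d * (c0.symm.trans e0) - b * (c1.symm.trans e1) + y 3 * hpf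
      · have c2 := (h' 2).1 m2
        refine ⟨(mul_eq_zero.1 (?_ : b * _ = 0)).resolve_left hb.1.ne', c2⟩
        rw [e1]
        linear_combination (-d) * (c0.symm.trans e0) - a * (c2.symm.trans e2) - y 3 * hpf
      · exact ⟨(h' 1).1 m1, (h' 2).1 m2⟩
    funext i
    fin_cases i
    exacts [c0, this.1, this.2, c3]
  rw [eq_of_subseq_of_mulVec_eq_zero hA hlt hx hy hAy hlim, hAy]

end ThirdClass

/-- `V` is not ergodic: there are a continuous function `f` on `S³` and an
interior point `x` whose Cesàro averages `(1/k) ∑_{n<k} f(Vⁿx)` do not converge. -/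
theorem stmt_19 (a12 a13 a14 a23 a24 a34 : ℝ)
    (h12 : a12 ∈ Set.Ioo (0 : ℝ) 1) (h13 : a13 ∈ Set.Ioo (0 : ℝ) 1)
    (h14 : a14 ∈ Set.Ioo (0 : ℝ) 1) (h23 : a23 ∈ Set.Ioo (0 : ℝ) 1)
    (h24 : a24 ∈ Set.Ioo (0 : ℝ) 1) (h34 : a34 ∈ Set.Ioo (0 : ℝ) 1)
    (V : (Fin 4 → ℝ) → (Fin 4 → ℝ)) (hV : V = volterra3 a12 a13 a14 a23 a24 a34) :
    ∃ f : (Fin 4 → ℝ) → ℝ, ∃ x : Fin 4 → ℝ,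
      ContinuousOn f simplex3 ∧ x ∈ simplex3 ∧ (∀ i, 0 < x i) ∧
      ¬ ∃ L : ℝ, Filter.Tendsto
        (fun k : ℕ => (1 / (k : ℝ)) * ∑ n ∈ Finset.range k, f (V^[n] x))
        Filter.atTop (nhds L) := by
  obtain ⟨x, hx, hnot⟩ : ∃ x ∈ openSimplex (Fin 4),
      ¬ ErgodicAt (thirdClassMatrix a12 a13 a14 a23 a24 a34) x := by
    rcases lt_trichotomy (a12 * a34 - a13 * a24 - a14 * a23) 0 with h | h | h
    · exact exists_not_ergodicAt_of_pfaffian_neg h12 h13 h14 h23 h24 h34 h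
    · exact exists_not_ergodicAt_of_pfaffian_zero h12 h13 h14 h23 h24 h34 h
    · exact exists_not_ergodicAt_of_pfaffian_pos h12 h13 h14 h23 h24 h34 h
  subst hV
  rw [ErgodicAt, volterraMap_thirdClassMatrix] at hnot
  push Not at hnot
  obtain ⟨f, hf, hL⟩ := hnot
  exact ⟨f, x, hf, openSimplex_subset hx, hx.1, fun ⟨L, h⟩ => hL L h⟩
end
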